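/- arXiv:1105.5983 — 13 statements merged into one kernel-verified Lean document; each statement's English description precedes it below -/
import Mathlib

section
/- The Lower Equilibrium bid profile of the GSP auction is strictly decreasing and lies below the valuations: b^L_1 > b^L_2 > ⋯ > b^L_n, and b^L_i ≤ v_i for every 2 ≤ i ≤ s+1. -/
/-- The Lower Equilibrium bid profile of the GSP auction is strictly decreasing and
lies below the valuations: `b^L_1 > b^L_2 > ⋯ > b^L_n`, and `b^L_i ≤ v_i` for every
`2 ≤ i ≤ s+1`. -/
theorem lowerEquilibrium_strictly_decreasing_and_below_valuations
    (s n : ℕ) (x v bL : ℕ → ℝ)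
    (hs : 1 ≤ s) (hn : s + 2 ≤ n)
    (hxdec : ∀ j, 1 ≤ j → j < s → x (j + 1) < x j)
    (hxpos : 0 < x s)
    (hx0 : ∀ j, s < j → x j = 0)
    (hvdec : ∀ i, 1 ≤ i → i < n → v (i + 1) < v i)
    (hvpos : 0 < v n)
    (hbL1 : bL 1 = v 1)
    (hbLmid : ∀ i, 2 ≤ i → i ≤ s + 1 →
      bL i * x (i - 1) = ∑ t ∈ Finset.Icc i (s + 1), v t * (x (t - 1) - x t))
    (hbLhi : ∀ i, s + 1 < i → bL i = v i) :
    (∀ i, 1 ≤ i → i < n → bL (i + 1) < bL i) ∧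
    (∀ i, 2 ≤ i → i ≤ s + 1 → bL i ≤ v i) := by
  have hxp : ∀ k j, 1 ≤ j → j + k = s → 0 < x j := by
    intro k
    induction k with
    | zero =>
      intro j h1 h2
      have : j = s := by omega
      rw [this]; exact hxpos
    | succ k ih =>
      intro j h1 h2
      have h3 := ih (j + 1) (by omega) (by omega)
      have h4 := hxdec j h1 (by omega)
      linarith
  have hlast : bL (s + 1) = v (s + 1) := by
    have h := hbLmid (s + 1) (by omega) le_rfl
    simp only [Finset.Icc_self, Finset.sum_singleton, Nat.add_sub_cancel,
      hx0 (s + 1) (by omega), sub_zero] at h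
    exact mul_right_cancel₀ hxpos.ne' h
  have hrec : ∀ i, 2 ≤ i → i ≤ s →
      bL i * x (i - 1) = v i * (x (i - 1) - x i) + bL (i + 1) * x i := by
    intro i h1 h2
    have h3 := hbLmid (i + 1) (by omega) (by omega)
    rw [Nat.add_sub_cancel] at h3
    rw [h3, hbLmid i h1 (by omega)]
    have hI : Finset.Icc (i + 1) (s + 1) = Finset.Ioc i (s + 1) := by
      ext t; simp only [Finset.mem_Icc, Finset.mem_Ioc]; omega
    rw [hI]
    exact (Finset.add_sum_Ioc_eq_sum_Icc (f := fun t => v t * (x (t - 1) - x t))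
      (by omega : i ≤ s + 1)).symm
  have hle : ∀ k i, 2 ≤ i → i + k = s + 1 → bL i ≤ v i := by
    intro k
    induction k with
    | zero =>
      intro i h1 h2
      have : i = s + 1 := by omega
      rw [this, hlast]
    | succ k ih =>
      intro i h1 h2
      have h3 := ih (i + 1) (by omega) (by omega)
      have h4 := hvdec i (by omega) (by omega)
      have h5 := hxp (s - i) i (by omega) (by omega)
      have h6 := hxp (s - (i - 1)) (i - 1) (by omega) (by omega)
      have h7 := hrec i h1 (by omega)
      refine le_of_mul_le_mul_right ?_ h6
      nlinarith
  refine ⟨?_, fun i h1 h2 => hle (s + 1 - i) i h1 (by omega)⟩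
  intro i h1 h2
  have h4 := hvdec i h1 h2
  rcases lt_or_ge s i with h | h
  · rw [hbLhi (i + 1) (by omega)]
    rcases Nat.lt_or_ge (s + 1) i with h' | h'
    · rw [hbLhi i h']; exact h4
    · have : i = s + 1 := by omega
      subst this
      rw [hlast]; exact h4
  · have h3 := hle (s - i) (i + 1) (by omega) (by omega)
    rcases Nat.lt_or_ge 1 i with h' | h'
    · have h6 := hxp (s - (i - 1)) (i - 1) (by omega) (by omega)
      have h7 := hrec i h' h
      have h8 := hxdec (i - 1) (by omega) (by omega)
      rw [Nat.sub_add_cancel h1] at h8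
      refine lt_of_mul_lt_mul_right ?_ h6.le
      nlinarith
    · have : i = 1 := by omega
      subst this
      rw [hbL1]; linarith
end

section
/- Fix 1 ≤ k < j−1 with j ≤ s. There exist bids b'_k and b'_j such that, in the GSP auction with all bidders other than k and j bidding their LE bids b^L, all n bids pairwise distinct, both bidders k and j obtain utility at least their LE utility and at least one of them obtains strictly more, if and only if the pair-deviation condition C(k,j) holds: Σ_{t=k+1}^{j−1} (x_{t−1} − x_t)(v_k − v_t) < a·v_j − a·Σ_{i=j+1}^{s+1} w_i v_i, where a = x_{j−1} − x_j and w_i = (x_{i−1} − x_i)/x_j. -/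
/-- In the GSP auction with `n` bidders and pairwise distinct bids `b`, the bidder with
the `r`-th highest bid is allocated slot `r` (with click-through rate `x r`, where
`x r = 0` for `r > s`) and pays per click the `(r+1)`-th highest bid, i.e. the highest
bid strictly below her own (`0` if there is none). `gspUtil n x v b i` is the resulting
utility of bidder `i`. -/
noncomputable def gspUtil (n : ℕ) (x v : ℕ → ℝ) (b : ℕ → ℝ) (i : ℕ) : ℝ :=
  (v i - (if h : ((Finset.Icc 1 n).filter (fun j => b j < b i)).Nonempty
            then ((Finset.Icc 1 n).filter (fun j => b j < b i)).sup' h b else 0)) *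
    x (((Finset.Icc 1 n).filter (fun j => b i < b j)).card + 1)

lemma gsp_util_le (n : ℕ) (x v b : ℕ → ℝ) (i m : ℕ) (hm : m ∈ Finset.Icc 1 n) (hb : b m < b i)
    (hx : 0 ≤ x (((Finset.Icc 1 n).filter (fun j => b i < b j)).card + 1)) :
    gspUtil n x v b i ≤
      (v i - b m) * x (((Finset.Icc 1 n).filter (fun j => b i < b j)).card + 1) := by
  unfold gspUtil
  have hmem : m ∈ (Finset.Icc 1 n).filter (fun j => b j < b i) := Finset.mem_filter.2 ⟨hm, hb⟩
  rw [dif_pos ⟨m, hmem⟩]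
  apply mul_le_mul_of_nonneg_right _ hx
  have := Finset.le_sup' b hmem
  linarith

lemma gsp_util_eq (n : ℕ) (x v b : ℕ → ℝ) (i m : ℕ) (hm : m ∈ Finset.Icc 1 n) (hb : b m < b i)
    (hmax : ∀ l ∈ Finset.Icc 1 n, b l < b i → b l ≤ b m) :
    gspUtil n x v b i =
      (v i - b m) * x (((Finset.Icc 1 n).filter (fun j => b i < b j)).card + 1) := by
  unfold gspUtil
  have hmem : m ∈ (Finset.Icc 1 n).filter (fun j => b j < b i) := Finset.mem_filter.2 ⟨hm, hb⟩
  rw [dif_pos ⟨m, hmem⟩]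
  have h1 := Finset.le_sup' b hmem
  have h2 : ((Finset.Icc 1 n).filter (fun j => b j < b i)).sup' ⟨m, hmem⟩ b ≤ b m := by
    apply Finset.sup'_le
    intro l hl
    rw [Finset.mem_filter] at hl
    exact hmax l hl.1 hl.2
  rw [le_antisymm h2 h1]

/-- Any bidder outside a set `S` containing `i`, `k`, `j` and everybody above `i` yields a price bound. -/
lemma gsp_util_dev (n : ℕ) (x v bL b : ℕ → ℝ) (i k j q : ℕ) (S : Finset ℕ)
    (hi : i ∈ Finset.Icc 1 n)
    (hanti : ∀ a c, 1 ≤ a → a ≤ c → c ≤ n → bL c ≤ bL a)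
    (hb : ∀ l, l ≠ k → l ≠ j → b l = bL l)
    (hd : ∀ l ∈ Finset.Icc 1 n, ∀ l' ∈ Finset.Icc 1 n, l ≠ l' → b l ≠ b l')
    (hx : 0 ≤ x (((Finset.Icc 1 n).filter (fun j => b i < b j)).card + 1))
    (hiS : i ∈ S) (hkS : k ∈ S) (hjS : j ∈ S)
    (hup : (Finset.Icc 1 n).filter (fun j => b i < b j) ⊆ S)
    (hq : q ≤ n) (hcard : ¬ Finset.Icc 1 q ⊆ S) :
    gspUtil n x v b i ≤
      (v i - bL q) * x (((Finset.Icc 1 n).filter (fun j => b i < b j)).card + 1) := by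
  obtain ⟨m, hm, hmS⟩ := Finset.not_subset.1 hcard
  rw [Finset.mem_Icc] at hm
  have hmn : m ∈ Finset.Icc 1 n := Finset.mem_Icc.2 ⟨hm.1, hm.2.trans hq⟩
  have hmi : m ≠ i := fun h => hmS (h ▸ hiS)
  have hmk : m ≠ k := fun h => hmS (h ▸ hkS)
  have hmj : m ≠ j := fun h => hmS (h ▸ hjS)
  have hlt : b m < b i := by
    rcases lt_trichotomy (b m) (b i) with h | h | h
    · exact h
    · exact absurd h (hd m hmn i hi hmi)
    · exact absurd (hup (Finset.mem_filter.2 ⟨hmn, h⟩)) hmS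
  refine (gsp_util_le n x v b i m hmn hlt hx).trans ?_
  apply mul_le_mul_of_nonneg_right _ hx
  have := hanti m q hm.1 hm.2 hq
  rw [hb m hmk hmj]
  linarith


/-- Characterization of pair deviations from the Lower Equilibrium of GSP: for
`1 ≤ k < j-1`, `j ≤ s`, the pair `(k,j)` has a (weak) deviation — i.e. there are bids
`b'_k, b'_j` such that, with everyone else bidding `b^L` and all bids pairwise distinct,
both `k` and `j` get at least their LE utility and one of them strictly more — if and
only if the pair-deviation condition `C(k,j)` holds:
`Σ_{t=k+1}^{j−1} (x_{t−1} − x_t)(v_k − v_t) < a·v_j − a·Σ_{i=j+1}^{s+1} w_i v_i`,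
where `a = x_{j−1} − x_j` and `w_i = (x_{i−1} − x_i)/x_j`. -/
theorem gsp_lowerEquilibrium_pair_deviation_iff
    (s n : ℕ) (x v bL : ℕ → ℝ)
    (hs : 1 ≤ s) (hn : s + 2 ≤ n)
    (hxdec : ∀ j, 1 ≤ j → j < s → x (j + 1) < x j)
    (hxpos : 0 < x s)
    (hx0 : ∀ j, s < j → x j = 0)
    (hvdec : ∀ i, 1 ≤ i → i < n → v (i + 1) < v i)
    (hvpos : 0 < v n)
    (hbL1 : bL 1 = v 1)
    (hbLmid : ∀ i, 2 ≤ i → i ≤ s + 1 →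
      bL i * x (i - 1) = ∑ t ∈ Finset.Icc i (s + 1), v t * (x (t - 1) - x t))
    (hbLhi : ∀ i, s + 1 < i → bL i = v i)
    (k j : ℕ) (hk : 1 ≤ k) (hkj : k + 1 < j) (hj : j ≤ s) :
    (∃ b' : ℕ → ℝ,
        (∀ i, i ≠ k → i ≠ j → b' i = bL i) ∧
        (∀ i ∈ Finset.Icc 1 n, ∀ i' ∈ Finset.Icc 1 n, i ≠ i' → b' i ≠ b' i') ∧
        gspUtil n x v bL k ≤ gspUtil n x v b' k ∧
        gspUtil n x v bL j ≤ gspUtil n x v b' j ∧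
        (gspUtil n x v bL k < gspUtil n x v b' k ∨
          gspUtil n x v bL j < gspUtil n x v b' j)) ↔
    (∑ t ∈ Finset.Icc (k + 1) (j - 1), (x (t - 1) - x t) * (v k - v t) <
      (x (j - 1) - x j) * v j -
        (x (j - 1) - x j) *
          ∑ i ∈ Finset.Icc (j + 1) (s + 1), ((x (i - 1) - x i) / x j) * v i) := by
  -- click-through rates
  have hxstep : ∀ r, 1 ≤ r → r ≤ s → x (r + 1) < x r := by
    intro r h1 h2
    rcases h2.lt_or_eq with h | h
    · exact hxdec r h1 h
    · rw [hx0 (r + 1) (by omega), h]; exact hxpos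
  have hxs : ∀ d r, r + d = s → 1 ≤ r → 0 < x r := by
    intro d
    induction d with
    | zero => intro r h _; have : r = s := by omega
              rw [this]; exact hxpos
    | succ d ih => intro r h h1
                   have := ih (r + 1) (by omega) (by omega)
                   linarith [hxstep r h1 (by omega)]
  have hxp : ∀ r, 1 ≤ r → r ≤ s → 0 < x r := fun r h1 h2 => hxs (s - r) r (by omega) h1
  have hxnn : ∀ r, 1 ≤ r → 0 ≤ x r := by
    intro r h1
    rcases le_or_gt r s with h | h
    · exact (hxp r h1 h).le
    · exact (hx0 r h).ge
  -- valuations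
  have hvs : ∀ d a, 1 ≤ a → a + d ≤ n → v (a + d) ≤ v a := by
    intro d
    induction d with
    | zero => intro a _ _; exact le_refl _
    | succ d ih => intro a h1 h2
                   have := ih a h1 (by omega)
                   have h3 := hvdec (a + d) (by omega) (by omega)
                   rw [← add_assoc]; linarith
  have hvle : ∀ a c, 1 ≤ a → a ≤ c → c ≤ n → v c ≤ v a := by
    intro a c h1 h2 h3
    obtain ⟨d, rfl⟩ := Nat.exists_eq_add_of_le h2
    exact hvs d a h1 h3
  have hvlt : ∀ a c, 1 ≤ a → a < c → c ≤ n → v c < v a := by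
    intro a c h1 h2 h3
    have := hvle (a + 1) c (by omega) h2 h3
    linarith [hvdec a h1 (by omega)]
  -- recursion for the bids
  have hlast : bL (s + 1) = v (s + 1) := by
    have h := hbLmid (s + 1) (by omega) le_rfl
    rw [Finset.Icc_self, Finset.sum_singleton, hx0 (s + 1) (by omega), Nat.add_sub_cancel,
      sub_zero] at h
    exact mul_right_cancel₀ hxpos.ne' h
  have hrec : ∀ r, 1 ≤ r → r ≤ s →
      bL (r + 1) * x r = v (r + 1) * (x r - x (r + 1)) + bL (r + 2) * x (r + 1) := by
    intro r h1 h2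
    rcases h2.lt_or_eq with h | h
    · have e1 := hbLmid (r + 1) (by omega) (by omega)
      have e2 := hbLmid (r + 2) (by omega) (by omega)
      rw [← Finset.add_sum_Ioc_eq_sum_Icc (by omega : r + 1 ≤ s + 1)] at e1
      have e3 : Finset.Ioc (r + 1) (s + 1) = Finset.Icc (r + 2) (s + 1) := by
        ext t; simp only [Finset.mem_Ioc, Finset.mem_Icc]; omega
      rw [e3, ← e2] at e1
      simpa using e1
    · subst h
      rw [hx0 (r + 1) (by omega), hlast]; ring
  have hble : ∀ d r, r + d = s → 1 ≤ r → bL (r + 1) ≤ v (r + 1) := by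
    intro d
    induction d with
    | zero => intro r h _; have : r = s := by omega
              rw [this, hlast]
    | succ d ih =>
      intro r h h1
      have h2 := ih (r + 1) (by omega) (by omega)
      have h3 := hrec r h1 (by omega)
      have h4 := hvdec (r + 1) (by omega) (by omega)
      have h5 := hxp r h1 (by omega)
      have h6 := hxp (r + 1) (by omega) (by omega)
      have h7 : bL (r + 1) * x r ≤ v (r + 1) * x r := by
        have : bL (r + 2) * x (r + 1) ≤ v (r + 1) * x (r + 1) :=
          mul_le_mul_of_nonneg_right (by linarith) h6.le
        nlinarith
      exact le_of_mul_le_mul_right h7 h5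
  have hblv : ∀ i, 1 ≤ i → i ≤ n → bL i ≤ v i := by
    intro i h1 h2
    rcases Nat.lt_or_ge (s + 1) i with h | h
    · exact (hbLhi i h).le
    · rcases h1.eq_or_lt with h3 | h3
      · rw [← h3, hbL1]
      · have := hble (s + 1 - i) (i - 1) (by omega) (by omega)
        rwa [Nat.sub_add_cancel h1] at this
  have hbstep : ∀ i, 1 ≤ i → i < n → bL (i + 1) < bL i := by
    intro i h1 h2
    have h3 := hblv (i + 1) (by omega) (by omega)
    have h4 := hvdec i h1 h2
    rcases h1.eq_or_lt with h | h
    · rw [← h, hbL1]; rw [← h] at h3 h4; linarith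
    · rcases Nat.lt_or_ge s i with h5 | h5
      · have : bL i = v i := by
          rcases Nat.lt_or_ge (s + 1) i with h6 | h6
          · exact hbLhi i h6
          · have : i = s + 1 := by omega
            rw [this, hlast]
        linarith
      · obtain ⟨r, rfl⟩ : ∃ r, i = r + 1 := ⟨i - 1, by omega⟩
        have h6 := hrec r (by omega) (by omega)
        have h7 := hxp r (by omega) (by omega)
        have h8 := hxstep r (by omega) (by omega)
        have h9 : bL (r + 2) * x r < bL (r + 1) * x r := by
          have : bL (r + 2) * (x r - x (r + 1)) < v (r + 1) * (x r - x (r + 1)) :=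
            mul_lt_mul_of_pos_right (by linarith) (by linarith)
          nlinarith
        exact lt_of_mul_lt_mul_right h9 h7.le
  have hbs : ∀ d a, 1 ≤ a → a + d ≤ n → bL (a + d) ≤ bL a := by
    intro d
    induction d with
    | zero => intro a _ _; exact le_refl _
    | succ d ih => intro a h1 h2
                   have := ih a h1 (by omega)
                   have h3 := hbstep (a + d) (by omega) (by omega)
                   rw [← add_assoc]; linarith
  have hbanti : ∀ a c, 1 ≤ a → a ≤ c → c ≤ n → bL c ≤ bL a := by
    intro a c h1 h2 h3
    obtain ⟨d, rfl⟩ := Nat.exists_eq_add_of_le h2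
    exact hbs d a h1 h3
  have hblt : ∀ a c, 1 ≤ a → a < c → c ≤ n → bL c < bL a := by
    intro a c h1 h2 h3
    have := hbanti (a + 1) c (by omega) h2 h3
    linarith [hbstep a h1 (by omega)]
  have hbiff : ∀ a c, 1 ≤ a → a ≤ n → 1 ≤ c → c ≤ n → bL a < bL c → c < a := by
    intro a c h1 h2 h3 h4 h5
    by_contra h
    have := hbanti a c h1 (by omega) h4
    linarith
  -- utility at LE prices
  set U : ℕ → ℕ → ℝ := fun i r => (v i - bL (r + 1)) * x r with hU
  have hUstep : ∀ i r, 1 ≤ r → r ≤ s →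
      U i r - U i (r + 1) = (x r - x (r + 1)) * (v i - v (r + 1)) := by
    intro i r h1 h2
    have := hrec r h1 h2
    simp only [hU]
    linarith
  have hU0 : ∀ i r, s < r → U i r = 0 := by
    intro i r h; simp only [hU]; rw [hx0 r h, mul_zero]
  have hUdown : ∀ i, 1 ≤ i → i ≤ s → ∀ d, U i (i + d) ≤ U i i := by
    intro i h1 h2 d
    induction d with
    | zero => exact le_refl _
    | succ d ih =>
      rcases Nat.lt_or_ge s (i + d) with h | h
      · rw [hU0 i (i + (d + 1)) (by omega)]; rw [hU0 i (i + d) h] at ih; exact ih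
      · have e := hUstep i (i + d) (by omega) h
        have h3 := hxstep (i + d) (by omega) h
        have h4 := hvle i (i + d + 1) h1 (by omega) (by omega)
        have : 0 ≤ (x (i + d) - x (i + d + 1)) * (v i - v (i + d + 1)) :=
          mul_nonneg (by linarith) (by linarith)
        rw [← add_assoc]; linarith
  have hUdownlt : ∀ i, 1 ≤ i → i ≤ s → ∀ r, i < r → U i r < U i i := by
    intro i h1 h2 r hr
    obtain ⟨d, rfl⟩ := Nat.exists_eq_add_of_le hr
    have hA : ∀ d, U i (i + 1 + d) ≤ U i (i + 1) := by
      intro d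
      induction d with
      | zero => exact le_refl _
      | succ d ih =>
        rcases Nat.lt_or_ge s (i + 1 + d) with h | h
        · rw [hU0 i (i + 1 + (d + 1)) (by omega)]; rw [hU0 i (i + 1 + d) h] at ih; exact ih
        · have e := hUstep i (i + 1 + d) (by omega) h
          have h3 := hxstep (i + 1 + d) (by omega) h
          have h4 := hvle i (i + 1 + d + 1) h1 (by omega) (by omega)
          have : 0 ≤ (x (i + 1 + d) - x (i + 1 + d + 1)) * (v i - v (i + 1 + d + 1)) :=
            mul_nonneg (by linarith) (by linarith)
          rw [← add_assoc]; linarith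
    have e := hUstep i i h1 h2
    have h3 := hxstep i h1 h2
    have h4 := hvdec i h1 (by omega)
    have : 0 < (x i - x (i + 1)) * (v i - v (i + 1)) := mul_pos (by linarith) (by linarith)
    linarith [hA d]
  have hUup : ∀ d r i, r + d = i → 1 ≤ r → i ≤ s → U i r ≤ U i i := by
    intro d
    induction d with
    | zero => intro r i h _ _; have : r = i := by omega
              rw [this]
    | succ d ih =>
      intro r i h h1 h2
      have h3 := ih (r + 1) i (by omega) (by omega) h2
      have e := hUstep i r h1 (by omega)
      have h4 := hxstep r h1 (by omega)
      have h5 := hvle (r + 1) i (by omega) (by omega) (by omega)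
      have : (x r - x (r + 1)) * (v i - v (r + 1)) ≤ 0 :=
        mul_nonpos_of_nonneg_of_nonpos (by linarith) (by linarith)
      linarith
  have hUmax : ∀ i r, 1 ≤ i → i ≤ s → 1 ≤ r → U i r ≤ U i i := by
    intro i r h1 h2 h3
    rcases le_total r i with h | h
    · exact hUup (i - r) r i (by omega) h3 h2
    · obtain ⟨d, rfl⟩ := Nat.exists_eq_add_of_le h
      exact hUdown i h1 h2 d
  have hLE : ∀ i, 1 ≤ i → i ≤ s → gspUtil n x v bL i = U i i := by
    intro i h1 h2
    rw [gsp_util_eq n x v bL i (i + 1) (Finset.mem_Icc.2 ⟨by omega, by omega⟩)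
      (hbstep i h1 (by omega))]
    · have : (Finset.Icc 1 n).filter (fun j => bL i < bL j) = Finset.Icc 1 (i - 1) := by
        ext t
        simp only [Finset.mem_filter, Finset.mem_Icc]
        constructor
        · rintro ⟨⟨a, b⟩, c⟩
          have := hbiff i t h1 (by omega) a b c
          omega
        · rintro ⟨a, b⟩
          exact ⟨⟨a, by omega⟩, hblt t i a (by omega) (by omega)⟩
      rw [this, Nat.card_Icc, show i - 1 + 1 - 1 + 1 = i by omega]
    · intro l hl hlt
      rw [Finset.mem_Icc] at hl
      have := hbiff l i hl.1 hl.2 h1 (by omega) hlt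
      exact hbanti (i + 1) l (by omega) this hl.2
  -- reformulation of C(k,j)
  have hC : (∑ t ∈ Finset.Icc (k + 1) (j - 1), (x (t - 1) - x t) * (v k - v t) <
      (x (j - 1) - x j) * v j -
        (x (j - 1) - x j) *
          ∑ i ∈ Finset.Icc (j + 1) (s + 1), ((x (i - 1) - x i) / x j) * v i) ↔
      U k k < (v k - bL (j + 1)) * x (j - 1) := by
    have htel : ∀ d, k + d ≤ s → ∑ t ∈ Finset.Icc (k + 1) (k + d), (x (t - 1) - x t) * (v k - v t)
        = U k k - U k (k + d) := by
      intro d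
      induction d with
      | zero => intro _; simp
      | succ d ih =>
        intro h
        rw [← add_assoc, Finset.sum_Icc_succ_top (by omega), ih (by omega)]
        have := hUstep k (k + d) (by omega) (by omega)
        rw [Nat.add_sub_cancel]; linarith
    have h1 := htel (j - 1 - k) (by omega)
    rw [show k + (j - 1 - k) = j - 1 by omega] at h1
    have hxj := hxp j (by omega) hj
    have h2 : ∑ i ∈ Finset.Icc (j + 1) (s + 1), ((x (i - 1) - x i) / x j) * v i = bL (j + 1) := by
      have := hbLmid (j + 1) (by omega) (by omega)
      rw [Nat.add_sub_cancel] at this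
      rw [eq_comm, ← mul_right_cancel_iff_of_pos hxj, this, Finset.sum_mul]
      apply Finset.sum_congr rfl
      intro t _
      field_simp
    have h3 := hrec (j - 1) (by omega) (by omega)
    rw [show j - 1 + 2 = j + 1 by omega, show j - 1 + 1 = j by omega] at h3
    have h4 : U k (j - 1) = (v k - bL j) * x (j - 1) := by
      simp only [hU]; rw [show j - 1 + 1 = j by omega]
    rw [h1, h2, h4]
    constructor <;> intro h <;> nlinarith
  rw [hC, hLE k hk (by omega), hLE j (by omega) hj]
  constructor
  · rintro ⟨b, hb, hd, hgk, hgj, hg⟩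
    have hkn : k ∈ Finset.Icc 1 n := Finset.mem_Icc.2 ⟨hk, by omega⟩
    have hjn : j ∈ Finset.Icc 1 n := Finset.mem_Icc.2 ⟨by omega, by omega⟩
    -- lower player
    have hlow : ∀ i u, i ∈ Finset.Icc 1 n → u ∈ Finset.Icc 1 n → (i = k ∧ u = j ∨ i = j ∧ u = k) →
        b i < b u → gspUtil n x v b i ≤
          U i (((Finset.Icc 1 n).filter (fun j => b i < b j)).card + 1) := by
      intro i u hi hu hiu hlt
      set A := (Finset.Icc 1 n).filter (fun j => b i < b j) with hA
      have huA : u ∈ A := Finset.mem_filter.2 ⟨hu, hlt⟩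
      rcases Nat.lt_or_ge s (A.card + 1) with h | h
      · rw [hU0 _ _ h]; unfold gspUtil; rw [← hA, hx0 _ h, mul_zero]
      · apply gsp_util_dev n x v bL b i k j (A.card + 1 + 1) (insert i A) hi hbanti hb hd
          (hxnn _ (by omega)) (Finset.mem_insert_self _ _)
        · rcases hiu with ⟨rfl, rfl⟩ | ⟨rfl, rfl⟩ <;> simp [huA]
        · rcases hiu with ⟨rfl, rfl⟩ | ⟨rfl, rfl⟩ <;> simp [huA]
        · exact Finset.subset_insert _ _
        · omega
        · intro hsub
          have h1 := Finset.card_le_card hsub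
          have h2 := Finset.card_insert_le i A
          rw [Nat.card_Icc] at h1
          omega
    -- upper player
    have hupp1 : ∀ i l, i ∈ Finset.Icc 1 n → l ∈ Finset.Icc 1 n →
        (i = k ∧ l = j ∨ i = j ∧ l = k) → 
        ((Finset.Icc 1 n).filter (fun j => b i < b j)).card + 1 < j - 1 →
        gspUtil n x v b i ≤ U i (((Finset.Icc 1 n).filter (fun j => b i < b j)).card + 1) := by
      intro i l hi hl hil hr
      set A := (Finset.Icc 1 n).filter (fun j => b i < b j) with hA
      have hjS : j ∈ insert l (insert i A) := by
        rcases hil with ⟨rfl, rfl⟩ | ⟨rfl, rfl⟩ <;> simp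
      apply gsp_util_dev n x v bL b i k j (A.card + 1 + 1) (insert l (insert i A)) hi hbanti hb hd
          (hxnn _ (by omega)) (by simp)
      · rcases hil with ⟨rfl, rfl⟩ | ⟨rfl, rfl⟩ <;> simp
      · exact hjS
      · exact (Finset.subset_insert _ _).trans (Finset.subset_insert _ _)
      · omega
      · intro hsub
        have hsub2 : Finset.Icc 1 (A.card + 1 + 1) ⊆ (insert l (insert i A)).erase j := by
          intro t ht
          refine Finset.mem_erase.2 ⟨?_, hsub ht⟩
          rw [Finset.mem_Icc] at ht
          omega
        have h1 := Finset.card_le_card hsub2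
        rw [Finset.card_erase_of_mem hjS, Nat.card_Icc] at h1
        have h2 := Finset.card_insert_le i A
        have h3 := Finset.card_insert_le l (insert i A)
        omega
    have hupp2 : ∀ i l, i ∈ Finset.Icc 1 n → l ∈ Finset.Icc 1 n →
        (i = k ∧ l = j ∨ i = j ∧ l = k) → 
        ((Finset.Icc 1 n).filter (fun j => b i < b j)).card + 1 ≤ s →
        gspUtil n x v b i ≤
          (v i - bL (((Finset.Icc 1 n).filter (fun j => b i < b j)).card + 1 + 2)) *
          x (((Finset.Icc 1 n).filter (fun j => b i < b j)).card + 1) := by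
      intro i l hi hl hil hr
      set A := (Finset.Icc 1 n).filter (fun j => b i < b j) with hA
      apply gsp_util_dev n x v bL b i k j (A.card + 1 + 2) (insert l (insert i A)) hi hbanti hb hd
          (hxnn _ (by omega)) (by simp)
      · rcases hil with ⟨rfl, rfl⟩ | ⟨rfl, rfl⟩ <;> simp
      · rcases hil with ⟨rfl, rfl⟩ | ⟨rfl, rfl⟩ <;> simp
      · exact (Finset.subset_insert _ _).trans (Finset.subset_insert _ _)
      · omega
      · intro hsub
        have h1 := Finset.card_le_card hsub
        rw [Nat.card_Icc] at h1
        have h2 := Finset.card_insert_le i A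
        have h3 := Finset.card_insert_le l (insert i A)
        omega
    have hrank : ∀ i u, u ∈ Finset.Icc 1 n → b i < b u →
        ((Finset.Icc 1 n).filter (fun j => b u < b j)).card <
        ((Finset.Icc 1 n).filter (fun j => b i < b j)).card := by
      intro i u hu hlt
      apply Finset.card_lt_card
      rw [Finset.ssubset_iff_of_subset]
      · exact ⟨u, Finset.mem_filter.2 ⟨hu, hlt⟩, by simp⟩
      · intro t ht
        rw [Finset.mem_filter] at ht ⊢
        exact ⟨ht.1, hlt.trans ht.2⟩
    rcases lt_or_gt_of_ne (hd k hkn j hjn (by omega)) with hlt | hlt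
    · -- k is the lower player: impossible
      exfalso
      have h1 := hlow k j hkn hjn (Or.inl ⟨rfl, rfl⟩) hlt
      have h2 := hrank k j hjn hlt
      have h3 : ¬ (k < ((Finset.Icc 1 n).filter (fun j => b k < b j)).card + 1) := by
        intro h
        have := hUdownlt k hk (by omega) _ h
        linarith
      have h4 := hupp1 j k hjn hkn (Or.inr ⟨rfl, rfl⟩) (by omega)
      have h5 := hUmax j _ (by omega) hj (Nat.le_add_left 1 _) |> h4.trans
      have h6 := hUmax k _ hk (by omega) (Nat.le_add_left 1 _) |> h1.trans
      rcases hg with h | h <;> linarith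
    · have h1 := hlow j k hjn hkn (Or.inr ⟨rfl, rfl⟩) hlt
      have h2 := hrank j k hkn hlt
      have h3 : ¬ (j < ((Finset.Icc 1 n).filter (fun t => b j < b t)).card + 1) := by
        intro h
        have := hUdownlt j (by omega) hj _ h
        linarith
      have h6 := hUmax j _ (by omega) hj (Nat.le_add_left 1 _) |> h1.trans
      have hgk' : U k k < gspUtil n x v b k := by
        rcases hg with h | h
        · exact h
        · linarith
      have h4 : ¬ (((Finset.Icc 1 n).filter (fun t => b k < b t)).card + 1 < j - 1) := by
        intro h
        have h4 := hupp1 k j hkn hjn (Or.inl ⟨rfl, rfl⟩) h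
        have h5 := hUmax k _ hk (by omega) (Nat.le_add_left 1 _) |> h4.trans
        linarith
      have h5 : ((Finset.Icc 1 n).filter (fun t => b k < b t)).card + 1 = j - 1 := by omega
      have h7 := hupp2 k j hkn hjn (Or.inl ⟨rfl, rfl⟩) (by omega)
      rw [h5, show j - 1 + 2 = j + 1 by omega] at h7
      linarith
  · intro h
    have hxj := hxp (j - 1) (by omega) (by omega)
    have hT : bL (j + 1) < v k - U k k / x (j - 1) := by
      rw [← div_lt_iff₀ hxj] at h
      linarith
    obtain ⟨β, hβ1, hβ2⟩ := exists_between (lt_min hT (hbstep j (by omega) (by omega)))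
    have hβ3 : β < bL j := hβ2.trans_le (min_le_right _ _)
    have hβ4 : U k k < (v k - β) * x (j - 1) := by
      rw [← div_lt_iff₀ hxj]
      linarith [hβ2.trans_le (min_le_left _ _)]
    set b : ℕ → ℝ := fun i => if i = k then bL j else if i = j then β else bL i with hbdef
    have hbk : b k = bL j := by simp [hbdef]
    have hbj : b j = β := by simp [hbdef, show j ≠ k by omega]
    have hbo : ∀ i, i ≠ k → i ≠ j → b i = bL i := by
      intro i h1 h2; simp [hbdef, h1, h2]
    have hlo : ∀ i, 1 ≤ i → i < j → bL j < bL i := fun i h1 h2 => hblt i j h1 h2 (by omega)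
    have hhi : ∀ i, j < i → i ≤ n → bL i < β := fun i h1 h2 =>
      (hbanti (j + 1) i (by omega) h1 h2).trans_lt hβ1
    have hkn : k ∈ Finset.Icc 1 n := Finset.mem_Icc.2 ⟨hk, by omega⟩
    have hjn : j ∈ Finset.Icc 1 n := Finset.mem_Icc.2 ⟨by omega, by omega⟩
    have huk : gspUtil n x v b k = (v k - β) * x (j - 1) := by
      rw [gsp_util_eq n x v b k j hjn (by rw [hbk, hbj]; exact hβ3)]
      · have : (Finset.Icc 1 n).filter (fun t => b k < b t) = (Finset.Icc 1 (j - 1)).erase k := by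
          ext t
          simp only [Finset.mem_filter, Finset.mem_Icc, Finset.mem_erase]
          rw [hbk]
          constructor
          · rintro ⟨⟨a, c⟩, d⟩
            have e1 : t ≠ k := by rintro rfl; rw [hbk] at d; exact lt_irrefl _ d
            have e2 : t ≠ j := by rintro rfl; rw [hbj] at d; linarith
            rw [hbo t e1 e2] at d
            have := hbiff j t (by omega) (by omega) a c d
            exact ⟨e1, a, by omega⟩
          · rintro ⟨a, c, d⟩
            rw [hbo t a (by omega)]
            exact ⟨⟨c, by omega⟩, hlo t c (by omega)⟩
        rw [this, Finset.card_erase_of_mem (Finset.mem_Icc.2 ⟨hk, by omega⟩), Nat.card_Icc, hbj,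
          show j - 1 + 1 - 1 - 1 + 1 = j - 1 by omega]
      · intro l hl hlt
        rw [Finset.mem_Icc] at hl
        rw [hbk] at hlt
        rw [hbj]
        by_cases e1 : l = k
        · subst e1; rw [hbk] at hlt; exact absurd hlt (lt_irrefl _)
        · by_cases e2 : l = j
          · rw [e2, hbj]
          · rw [hbo l e1 e2] at hlt ⊢
            have := hbiff l j hl.1 hl.2 (by omega) (by omega) hlt
            exact (hhi l this hl.2).le
    have huj : gspUtil n x v b j = U j j := by
      have hb1 : b (j + 1) = bL (j + 1) := hbo _ (by omega) (by omega)
      rw [gsp_util_eq n x v b j (j + 1) (Finset.mem_Icc.2 ⟨by omega, by omega⟩)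
        (by rw [hb1, hbj]; exact hβ1)]
      · have : (Finset.Icc 1 n).filter (fun t => b j < b t) = Finset.Icc 1 (j - 1) := by
          ext t
          simp only [Finset.mem_filter, Finset.mem_Icc]
          rw [hbj]
          constructor
          · rintro ⟨⟨a, c⟩, d⟩
            refine ⟨a, ?_⟩
            by_contra hh
            rcases Nat.lt_or_ge j t with e | e
            · rw [hbo t (by omega) (by omega)] at d
              linarith [hhi t e c]
            · have : t = j := by omega
              rw [this, hbj] at d
              exact lt_irrefl _ d
          · rintro ⟨a, c⟩
            refine ⟨⟨a, by omega⟩, ?_⟩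
            by_cases e : t = k
            · rw [e, hbk]; exact hβ3
            · rw [hbo t e (by omega)]
              exact hβ3.trans (hlo t a (by omega))
        rw [this, Nat.card_Icc, hb1, show j - 1 + 1 - 1 + 1 = j by omega]
      · intro l hl hlt
        rw [Finset.mem_Icc] at hl
        rw [hbj] at hlt
        rw [hb1]
        by_cases e1 : l = k
        · subst e1; rw [hbk] at hlt; linarith
        · by_cases e2 : l = j
          · rw [e2, hbj] at hlt; exact absurd hlt (lt_irrefl _)
          · rw [hbo l e1 e2] at hlt ⊢
            have := hbiff l j hl.1 hl.2 (by omega) (by omega) (hlt.trans hβ3)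
            exact hbanti (j + 1) l (by omega) this hl.2
    have hk_ne : ∀ i, 1 ≤ i → i ≤ n → i ≠ k → b i ≠ b k := by
      intro i h1 h2 h3
      rw [hbk]
      by_cases e : i = j
      · rw [e, hbj]; exact hβ3.ne
      · rw [hbo i h3 e]
        rcases lt_or_gt_of_ne e with e | e
        · exact (hlo i h1 e).ne'
        · exact ((hhi i e h2).trans hβ3).ne
    have hj_ne : ∀ i, 1 ≤ i → i ≤ n → i ≠ k → i ≠ j → b i ≠ b j := by
      intro i h1 h2 h3 e
      rw [hbj, hbo i h3 e]
      rcases lt_or_gt_of_ne e with e | e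
      · exact (hβ3.trans (hlo i h1 e)).ne'
      · exact (hhi i e h2).ne
    refine ⟨b, hbo, ?_, ?_, ?_, ?_⟩
    · intro i hi i' hi' hne
      rw [Finset.mem_Icc] at hi hi'
      by_cases e1 : i = k
      · subst e1; exact (hk_ne i' hi'.1 hi'.2 hne.symm).symm
      by_cases e2 : i' = k
      · subst e2; exact hk_ne i hi.1 hi.2 hne
      by_cases e3 : i = j
      · subst e3; exact (hj_ne i' hi'.1 hi'.2 e2 hne.symm).symm
      by_cases e4 : i' = j
      · subst e4; exact hj_ne i hi.1 hi.2 e1 hne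
      rw [hbo i e1 e3, hbo i' e2 e4]
      rcases lt_or_gt_of_ne hne with e | e
      · exact (hblt i i' hi.1 e hi'.2).ne'
      · exact (hblt i' i hi'.1 e hi.2).ne
    · rw [huk]; exact hβ4.le
    · rw [huj]
    · left; rw [huk]; exact hβ4
end

section
/- For every 1 ≤ k ≤ s−2, the pair (k, k+2) can deviate from the Upper Equilibrium: (v_k − b^U_{k+1})·x_k < (v_k − b^U_{k+3})·x_{k+1}; that is, bidder k strictly gains by moving from slot k (paying b^U_{k+1}) to slot k+1 while paying b^U_{k+3}, the payment she faces after bidder k+2 lowers her bid to the next bid below. -/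
/-- In the Upper Equilibrium of GSP, for every `1 ≤ k ≤ s−2` the pair `(k, k+2)` can
deviate: `(v_k − b^U_{k+1})·x_k < (v_k − b^U_{k+3})·x_{k+1}`, i.e. bidder `k` strictly
gains by moving from slot `k` (paying `b^U_{k+1}`) to slot `k+1` while paying
`b^U_{k+3}`, the payment she faces after bidder `k+2` lowers her bid to the next bid
below. -/
theorem upperEquilibrium_pair_k_kPlusTwo_deviates
    (s n : ℕ) (x v bU : ℕ → ℝ)
    (hs : 3 ≤ s) (hn : s + 2 ≤ n)
    (hxdec : ∀ j, 1 ≤ j → j < s → x (j + 1) < x j)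
    (hxpos : 0 < x s)
    (hx0 : ∀ j, s < j → x j = 0)
    (hvdec : ∀ i, 1 ≤ i → i < n → v (i + 1) < v i)
    (hvpos : 0 < v n)
    (hbU : ∀ i, 2 ≤ i → i ≤ s + 1 →
      bU i * x (i - 1) = ∑ t ∈ Finset.Icc i (s + 1), v (t - 1) * (x (t - 1) - x t))
    (k : ℕ) (hk : 1 ≤ k) (hks : k ≤ s - 2) :
    (v k - bU (k + 1)) * x k < (v k - bU (k + 3)) * x (k + 1) := by
  have hpos : ∀ d j, 1 ≤ j → j + d = s → 0 < x j := by
    intro d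
    induction d with
    | zero => intro j _ h; obtain rfl : j = s := by omega
              exact hxpos
    | succ d ih =>
      intro j hj h
      exact (ih (j + 1) (by omega) (by omega)).trans (hxdec j hj (by omega))
  have hstep : ∀ i, 1 ≤ i → i + 1 ≤ s →
      bU (i + 1) * x i = v i * (x i - x (i + 1)) + bU (i + 2) * x (i + 1) := by
    intro i hi his
    have h1 := hbU (i + 1) (by omega) (by omega)
    have h2 := hbU (i + 2) (by omega) (by omega)
    rw [← Finset.add_sum_Ioc_eq_sum_Icc (by omega : i + 1 ≤ s + 1)] at h1
    have e : Finset.Ioc (i + 1) (s + 1) = Finset.Icc (i + 2) (s + 1) := by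
      ext t; simp only [Finset.mem_Ioc, Finset.mem_Icc]; omega
    rw [e, ← h2] at h1
    simpa using h1
  have hle : ∀ d j, 1 ≤ j → j + d = s → bU (j + 1) * x j ≤ v j * x j := by
    intro d
    induction d with
    | zero =>
      intro j hj h
      obtain rfl : j = s := by omega
      have h1 := hbU (j + 1) (by omega) (by omega)
      have h0 := hx0 (j + 1) (by omega)
      simp only [Finset.Icc_self, Finset.sum_singleton, Nat.add_sub_cancel, h0, sub_zero] at h1
      exact h1.le
    | succ d ih =>
      intro j hj h
      have h1 := ih (j + 1) (by omega) (by omega)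
      have h2 := hstep j hj (by omega)
      have h3 := hpos d (j + 1) (by omega) (by omega)
      have h4 := hvdec j hj (by omega)
      have h5 := mul_lt_mul_of_pos_right h4 h3
      have e : j + 1 + 1 = j + 2 := rfl
      rw [e] at h1
      linarith
  have a1 := hstep k hk (by omega)
  have a2 := hstep (k + 1) (by omega) (by omega)
  have a3 := hle (s - (k + 2)) (k + 2) (by omega) (by omega)
  have a4 := hpos (s - (k + 2)) (k + 2) (by omega) (by omega)
  have a5 := hxdec (k + 1) (by omega) (by omega)
  have a6 := hvdec (k + 1) (by omega) (by omega)
  have a7 := le_of_mul_le_mul_right a3 a4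
  simp only [add_assoc, Nat.reduceAdd] at a1 a2 a3 a4 a5 a6 a7
  have a8 : 0 < (v (k + 1) - bU (k + 3)) * (x (k + 1) - x (k + 2)) :=
    mul_pos (by linarith) (by linarith)
  linarith
end

section
/- Suppose the CTR sequence is convex: x_{i−1} − x_i ≥ x_i − x_{i+1} for all 2 ≤ i ≤ s, and the valuation sequence is convex: v_{i−1} − v_i ≥ v_i − v_{i+1} for all 2 ≤ i ≤ s. If 1 ≤ k < j−1, j ≤ s, and the pair-deviation condition C(k,j) holds, then j − k ≤ √s + 3. (Hence only O(s·√s) pairs can deviate from the Lower Equilibrium of GSP when CTRs and valuations are convex.) -/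
/-- Convexity: consecutive differences are antitone. -/
theorem aux_conv (s : ℕ) (x : ℕ → ℝ)
    (h : ∀ i, 2 ≤ i → i ≤ s → x i - x (i + 1) ≤ x (i - 1) - x i)
    (i : ℕ) (hi : 1 ≤ i) (q : ℕ) (hq : i + q ≤ s) :
    x (i + q) - x (i + q + 1) ≤ x i - x (i + 1) := by
  induction q with
  | zero => simp
  | succ q ih =>
    have h1 := h (i + (q + 1)) (by omega) hq
    have h2 := ih (by omega)
    have e : i + (q + 1) - 1 = i + q := by omega
    rw [e] at h1
    have e2 : i + (q + 1) = i + q + 1 := by omega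
    rw [e2] at h1 ⊢
    linarith

theorem aux_sum (n : ℕ) : ∑ q ∈ Finset.range n, ((q : ℝ) + 1) = n * (n + 1) / 2 := by
  induction n with
  | zero => simp
  | succ n ih => rw [Finset.sum_range_succ, ih]; push_cast; ring

/-- If CTRs and valuations are convex, then the pair-deviation condition `C(k,j)` for
the Lower Equilibrium of GSP implies `j − k ≤ √s + 3`; hence only `O(s·√s)` pairs can
deviate. -/
theorem convex_pair_deviation_distance_bound
    (s : ℕ) (x v : ℕ → ℝ)
    (hs : 1 ≤ s)
    (hxdec : ∀ i, 1 ≤ i → i < s → x (i + 1) < x i)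
    (hxpos : 0 < x s) (hxtop : x (s + 1) = 0)
    (hvdec : ∀ i, 1 ≤ i → i ≤ s → v (i + 1) < v i)
    (hvpos : 0 < v (s + 1))
    (hxconv : ∀ i, 2 ≤ i → i ≤ s → x i - x (i + 1) ≤ x (i - 1) - x i)
    (hvconv : ∀ i, 2 ≤ i → i ≤ s → v i - v (i + 1) ≤ v (i - 1) - v i)
    (k j : ℕ) (hk : 1 ≤ k) (hkj : k + 1 < j) (hj : j ≤ s)
    (hC : ∑ t ∈ Finset.Icc (k + 1) (j - 1), (x (t - 1) - x t) * (v k - v t) <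
      (x (j - 1) - x j) * v j -
        (x (j - 1) - x j) *
          ∑ i ∈ Finset.Icc (j + 1) (s + 1), ((x (i - 1) - x i) / x j) * v i) :
    (j : ℝ) - (k : ℝ) ≤ Real.sqrt s + 3 := by
  obtain ⟨n, rfl⟩ : ∃ n, j = k + 1 + n := ⟨j - (k + 1), by omega⟩
  obtain ⟨m, hm⟩ : ∃ m, s + 1 = k + 1 + n + m := ⟨s + 1 - (k + 1 + n), by omega⟩
  have hcx := aux_conv s x hxconv
  have hcv := aux_conv s v hvconv
  set j := k + 1 + n with hjdef
  have hdpos : 0 < v j - v (j + 1) := by linarith [hvdec j (by omega) hj]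
  set d := v j - v (j + 1) with hd
  have hxp : 0 < x j := by
    have key : ∀ q, j + q ≤ s → x (j + q) ≤ x j := by
      intro q
      induction q with
      | zero => intro _; simp
      | succ q ih =>
        intro hq
        have h1 := hxdec (j + q) (by omega) (by omega)
        have h2 := ih (by omega)
        have e : j + (q + 1) = j + q + 1 := by omega
        rw [e]; linarith
    have h1 := key (s - j) (by omega)
    have e : j + (s - j) = s := by omega
    rw [e] at h1
    linarith
  have ej : j - 1 + 1 = j := by omega
  have hapos : 0 < x (j - 1) - x j := by
    have h1 := hxdec (j - 1) (by omega) (by omega)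
    rw [ej] at h1
    linarith
  set a := x (j - 1) - x j with ha
  have hv1 : ∀ q, k + q ≤ j → (q : ℝ) * d ≤ v k - v (k + q) := by
    intro q
    induction q with
    | zero => intro _; simp
    | succ q ih =>
      intro hq
      have h1 := ih (by omega)
      have h2 := hcv (k + q) (by omega) (j - (k + q)) (by omega)
      have e : k + q + (j - (k + q)) = j := by omega
      rw [e] at h2
      have e2 : k + (q + 1) = k + q + 1 := by omega
      rw [e2]; push_cast; linarith
  have hv2 : ∀ q, j + q ≤ s + 1 → v j - v (j + q) ≤ (q : ℝ) * d := by
    intro q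
    induction q with
    | zero => intro _; simp
    | succ q ih =>
      intro hq
      have h1 := ih (by omega)
      have h2 := hcv j (by omega) q (by omega)
      have e2 : j + (q + 1) = j + q + 1 := by omega
      rw [e2]; push_cast; linarith
  -- lower bound for the left-hand side
  have hL : a * d * (n * (n + 1) / 2) ≤
      ∑ t ∈ Finset.Icc (k + 1) (j - 1), (x (t - 1) - x t) * (v k - v t) := by
    have e : Finset.Icc (k + 1) (j - 1) = Finset.Ico (k + 1) j := by
      ext t; simp only [Finset.mem_Icc, Finset.mem_Ico]; omega
    have e2 : j - (k + 1) = n := by omega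
    rw [e, Finset.sum_Ico_eq_sum_range, e2, ← aux_sum, Finset.mul_sum]
    apply Finset.sum_le_sum
    intro q hq
    rw [Finset.mem_range] at hq
    have h1 := hv1 (q + 1) (by omega)
    have h2 := hcx (k + q) (by omega) (j - 1 - (k + q)) (by omega)
    have e3 : k + q + (j - 1 - (k + q)) = j - 1 := by omega
    rw [e3, ej] at h2
    have e4 : k + 1 + q - 1 = k + q := by omega
    have e5 : k + 1 + q = k + q + 1 := by omega
    have e6 : k + (q + 1) = k + q + 1 := by omega
    rw [e4, e5]
    rw [e6] at h1
    push_cast at h1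
    calc a * d * ((q : ℝ) + 1) = a * (((q : ℝ) + 1) * d) := by ring
      _ ≤ _ := mul_le_mul h2 h1 (by positivity) (by linarith)
  -- upper bound for the right-hand side
  have e : Finset.Icc (j + 1) (s + 1) = Finset.Ico (j + 1) (j + 1 + m) := by
    ext t; simp only [Finset.mem_Icc, Finset.mem_Ico]; omega
  have e2 : j + 1 + m - (j + 1) = m := by omega
  rw [e, Finset.sum_Ico_eq_sum_range, e2] at hC
  have hmpos : (0 : ℝ) < m := by
    have : 0 < m := by omega
    exact_mod_cast this
  let w : ℕ → ℝ := fun q => (x (j + q) - x (j + (q + 1))) / x j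
  have hw1 : ∑ q ∈ Finset.range m, w q = 1 := by
    simp only [w]
    rw [← Finset.sum_div, Finset.sum_range_sub' (fun q => x (j + q)), ← hm, hxtop]
    simp [hxp.ne']
  have hanti : AntivaryOn w (fun q : ℕ => (q : ℝ) + 1) (Finset.range m : Set ℕ) := by
    intro p hp q hq hpq
    simp only [Finset.coe_range, Set.mem_Iio] at hp hq
    have hpq' : p < q := by
      have : (p : ℝ) < q := by simpa using hpq
      exact_mod_cast this
    have h1 := hcx (j + p) (by omega) (q - p) (by omega)
    have e3 : j + p + (q - p) = j + q := by omega
    rw [e3] at h1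
    exact div_le_div_of_nonneg_right h1 hxp.le
  have hcheb := hanti.card_mul_sum_le_sum_mul_sum
  rw [hw1, aux_sum, Finset.card_range] at hcheb
  have hwnn : ∀ q ∈ Finset.range m, 0 ≤ w q := by
    intro q hq
    rw [Finset.mem_range] at hq
    have h2 := hcx (j + q) (by omega) (s - (j + q)) (by omega)
    have e3 : j + q + (s - (j + q)) = s := by omega
    rw [e3, hxtop] at h2
    apply div_nonneg _ hxp.le
    have e4 : j + (q + 1) = j + q + 1 := by omega
    rw [e4]; linarith
  have hR : v j - ∑ q ∈ Finset.range m,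
      (x (j + 1 + q - 1) - x (j + 1 + q)) / x j * v (j + 1 + q)
      ≤ d * ∑ q ∈ Finset.range m, w q * ((q : ℝ) + 1) := by
    have e3 : v j = ∑ q ∈ Finset.range m, w q * v j := by
      rw [← Finset.sum_mul, hw1, one_mul]
    rw [e3, ← Finset.sum_sub_distrib, Finset.mul_sum]
    apply Finset.sum_le_sum
    intro q hq
    have h1 := hwnn q hq
    rw [Finset.mem_range] at hq
    have h2 := hv2 (q + 1) (by omega)
    have e4 : j + 1 + q - 1 = j + q := by omega
    have e5 : j + 1 + q = j + (q + 1) := by omega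
    rw [e4, e5]
    push_cast at h2
    change w q * v j - w q * v (j + (q + 1)) ≤ _
    have h3 := mul_le_mul_of_nonneg_left h2 h1
    linarith
  have hS : ∑ q ∈ Finset.range m, w q * ((q : ℝ) + 1) ≤ (m + 1) / 2 := by
    have h1 : (m : ℝ) * ∑ q ∈ Finset.range m, w q * ((q : ℝ) + 1) ≤ m * ((m + 1) / 2) := by
      linarith
    exact le_of_mul_le_mul_left h1 hmpos
  have hfin : a * d * ((n : ℝ) * (n + 1) / 2) < a * d * (((m : ℝ) + 1) / 2) := by
    have h1 := mul_le_mul_of_nonneg_left (hR.trans (mul_le_mul_of_nonneg_left hS hdpos.le)) hapos.le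
    rw [mul_sub] at h1
    calc _ ≤ _ := hL
      _ < _ := hC
      _ ≤ _ := h1
      _ = _ := by ring
  have hlt := lt_of_mul_lt_mul_left hfin (by positivity)
  have hmR : (s : ℝ) + 1 = k + 1 + n + m := by
    rw [hjdef] at hm
    exact_mod_cast hm
  have hkR : (1 : ℝ) ≤ k := by exact_mod_cast hk
  have hnn : (0 : ℝ) ≤ n := Nat.cast_nonneg n
  have hn : (n : ℝ) ≤ Real.sqrt s := by
    apply Real.le_sqrt_of_sq_le
    nlinarith
  rw [hjdef]
  push_cast
  linarith
end

section
/- Let β > 1. Suppose the CTR sequence is β-convex: x_{i−1} − x_i ≥ β·(x_i − x_{i+1}) for all 2 ≤ i ≤ s, and the valuation sequence is convex: v_{i−1} − v_i ≥ v_i − v_{i+1} for all 2 ≤ i ≤ s. If 1 ≤ k < j−1, j ≤ s, and the pair-deviation condition C(k,j) holds, then β^{j−k−1} < (s − j)/2 + (j − k) + 2. (Hence only O(s·log_β s) pairs can deviate from the Lower Equilibrium of GSP when CTRs are β-convex.) -/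
theorem aux_x (s : ℕ) (x : ℕ → ℝ) (hxtop : x (s + 1) = 0)
    (hc : ∀ i, 2 ≤ i → i ≤ s → x i - x (i + 1) ≤ x (i - 1) - x i) :
    ∀ n j : ℕ, 1 ≤ j → j + n = s → x (j + 1) * (n + 1) ≤ x j * n := by
  intro n
  induction n with
  | zero =>
    intro j _ h
    have : j = s := by omega
    subst this
    simp [hxtop]
  | succ n ih =>
    intro j h1 h
    have h2 := ih (j + 1) (by omega) (by omega)
    have h3 := hc (j + 1) (by omega) (by omega)
    simp only [Nat.add_sub_cancel] at h3
    push_cast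
    have hn : (0 : ℝ) ≤ n + 1 := by positivity
    nlinarith [mul_le_mul_of_nonneg_right h3 hn]

theorem aux_T (s : ℕ) (x v : ℕ → ℝ) (hxtop : x (s + 1) = 0)
    (hxnn : ∀ i, 1 ≤ i → i ≤ s + 1 → 0 ≤ x i)
    (hc : ∀ i, 2 ≤ i → i ≤ s → x i - x (i + 1) ≤ x (i - 1) - x i)
    (hvdec : ∀ i, 1 ≤ i → i ≤ s → v (i + 1) < v i)
    (hvconv : ∀ i, 2 ≤ i → i ≤ s → v i - v (i + 1) ≤ v (i - 1) - v i) :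
    ∀ n j : ℕ, 1 ≤ j → j + n = s →
      x j * v j - (v j - v (j + 1)) * x j * ((n : ℝ) / 2 + 1) ≤
        ∑ i ∈ Finset.Icc (j + 1) (s + 1), (x (i - 1) - x i) * v i := by
  intro n
  induction n with
  | zero =>
    intro j _ h
    have : j = s := by omega
    subst this
    simp [hxtop]
    apply le_of_eq
    ring
  | succ n ih =>
    intro j h1 h
    have h2 := ih (j + 1) (by omega) (by omega)
    have h3 := hvconv (j + 1) (by omega) (by omega)
    have h4 := aux_x s x hxtop hc (n + 1) j h1 h
    have h5 := hvdec j h1 (by omega)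
    have h6 := hxnn (j + 1) (by omega) (by omega)
    rw [← Finset.add_sum_Ioc_eq_sum_Icc (by omega : j + 1 ≤ s + 1),
      ← Finset.Icc_add_one_left_eq_Ioc]
    simp only [Nat.add_sub_cancel] at h3 ⊢
    push_cast at h4 ⊢
    have hn : (0 : ℝ) ≤ (n : ℝ) / 2 + 1 := by positivity
    have a1 := mul_le_mul_of_nonneg_right h3 (mul_nonneg h6 hn)
    have a2 := mul_le_mul_of_nonneg_left h4 (sub_pos.2 h5).le
    nlinarith

/-- If CTRs are `β`-convex (`β > 1`) and valuations are convex, then the pair-deviation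
condition `C(k,j)` for the Lower Equilibrium of GSP implies
`β^{j−k−1} < (s − j)/2 + (j − k) + 2`; hence only `O(s·log_β s)` pairs can deviate. -/
theorem beta_convex_pair_deviation_distance_bound
    (s : ℕ) (x v : ℕ → ℝ) (β : ℝ) (hβ : 1 < β)
    (hs : 1 ≤ s)
    (hxdec : ∀ i, 1 ≤ i → i < s → x (i + 1) < x i)
    (hxpos : 0 < x s) (hxtop : x (s + 1) = 0)
    (hvdec : ∀ i, 1 ≤ i → i ≤ s → v (i + 1) < v i)
    (hvpos : 0 < v (s + 1))
    (hxbconv : ∀ i, 2 ≤ i → i ≤ s → β * (x i - x (i + 1)) ≤ x (i - 1) - x i)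
    (hvconv : ∀ i, 2 ≤ i → i ≤ s → v i - v (i + 1) ≤ v (i - 1) - v i)
    (k j : ℕ) (hk : 1 ≤ k) (hkj : k + 1 < j) (hj : j ≤ s)
    (hC : ∑ t ∈ Finset.Icc (k + 1) (j - 1), (x (t - 1) - x t) * (v k - v t) <
      (x (j - 1) - x j) * v j -
        (x (j - 1) - x j) *
          ∑ i ∈ Finset.Icc (j + 1) (s + 1), ((x (i - 1) - x i) / x j) * v i) :
    β ^ (j - k - 1) < ((s : ℝ) - (j : ℝ)) / 2 + ((j : ℝ) - (k : ℝ)) + 2 := by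
  have hxp : ∀ i, 1 ≤ i → i ≤ s → 0 < x i := by
    have aux : ∀ n i, 1 ≤ i → i + n = s → 0 < x i := by
      intro n
      induction n with
      | zero =>
        intro i _ h
        rw [show i = s by omega]
        exact hxpos
      | succ n ih =>
        intro i h1 h
        exact (ih (i + 1) (by omega) (by omega)).trans (hxdec i h1 (by omega))
    intro i h1 h2
    exact aux (s - i) i h1 (by omega)
  have hxnn : ∀ i, 1 ≤ i → i ≤ s + 1 → 0 ≤ x i := by
    intro i h1 h2
    rcases Nat.lt_or_ge i (s + 1) with h | h
    · exact (hxp i h1 (by omega)).le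
    · rw [show i = s + 1 by omega, hxtop]
  have hd : ∀ i, 1 ≤ i → i ≤ s → 0 < x i - x (i + 1) := by
    intro i h1 h2
    rcases Nat.lt_or_ge i s with h | h
    · exact sub_pos.2 (hxdec i h1 h)
    · rw [show i = s by omega, hxtop]
      simpa using hxpos
  have hc : ∀ i, 2 ≤ i → i ≤ s → x i - x (i + 1) ≤ x (i - 1) - x i := by
    intro i h1 h2
    have := hd i (by omega) h2
    nlinarith [hxbconv i h1 h2]
  -- geometric growth and monotone increments
  have hgeo : ∀ m, k + m + 1 ≤ s →
      β ^ m * (x (k + m) - x (k + m + 1)) ≤ x k - x (k + 1) := by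
    intro m
    induction m with
    | zero => intro _; simp
    | succ m ih =>
      intro h
      have h1 := ih (by omega)
      have h2 := hxbconv (k + m + 1) (by omega) (by omega)
      simp only [Nat.add_sub_cancel] at h2
      have h3 := mul_le_mul_of_nonneg_left h2 (by positivity : 0 ≤ β ^ m)
      rw [pow_succ, ← add_assoc]
      linarith
  have he : ∀ m, k + m ≤ s → v (k + m) - v (k + m + 1) ≤ v k - v (k + 1) := by
    intro m
    induction m with
    | zero => intro _; simp
    | succ m ih =>
      intro h
      have h1 := ih (by omega)
      have h2 := hvconv (k + m + 1) (by omega) (by omega)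
      simp only [Nat.add_sub_cancel] at h2
      rw [← add_assoc]
      linarith
  have hvk : ∀ m, k + m ≤ s + 1 → v (k + m) ≤ v k := by
    intro m
    induction m with
    | zero => intro _; simp
    | succ m ih =>
      intro h
      exact (hvdec (k + m) (by omega) (by omega)).le.trans (ih (by omega))
  obtain ⟨p, rfl⟩ : ∃ p, j = k + p + 1 := ⟨j - k - 1, by omega⟩
  obtain ⟨n, hn⟩ : ∃ n, k + p + 1 + n = s := ⟨s - (k + p + 1), by omega⟩
  have hT := aux_T s x v hxtop hxnn hc hvdec hvconv n (k + p + 1) (by omega) hn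
  have hL : (x k - x (k + 1)) * (v k - v (k + 1)) ≤
      ∑ t ∈ Finset.Icc (k + 1) (k + p + 1 - 1), (x (t - 1) - x t) * (v k - v t) := by
    have := Finset.single_le_sum
      (f := fun t => (x (t - 1) - x t) * (v k - v t))
      (s := Finset.Icc (k + 1) (k + p + 1 - 1)) (fun t ht => by
        rw [Finset.mem_Icc] at ht
        have h1 := hd (t - 1) (by omega) (by omega)
        rw [Nat.sub_add_cancel (by omega)] at h1
        have h2 := hvk (t - k) (by omega)
        rw [Nat.add_sub_cancel' (by omega)] at h2
        exact mul_nonneg h1.le (sub_nonneg.2 h2))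
      (Finset.mem_Icc.2 ⟨le_refl (k + 1), by omega⟩)
    simpa using this
  have hg := hgeo p (by omega)
  have he' := he (p + 1) (by omega)
  rw [← add_assoc] at he'
  have hxj := hxp (k + p + 1) (by omega) hj
  have hej := sub_pos.2 (hvdec (k + p + 1) (by omega) hj)
  have ha := hd (k + p) (by omega) (by omega)
  have hS : ∑ i ∈ Finset.Icc (k + p + 1 + 1) (s + 1),
      ((x (i - 1) - x i) / x (k + p + 1)) * v i =
      (∑ i ∈ Finset.Icc (k + p + 1 + 1) (s + 1), (x (i - 1) - x i) * v i) / x (k + p + 1) := by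
    rw [Finset.sum_div]
    exact Finset.sum_congr rfl fun i _ => by ring
  rw [hS] at hC
  have hT' : v (k + p + 1) - (v (k + p + 1) - v (k + p + 1 + 1)) * ((n : ℝ) / 2 + 1) ≤
      (∑ i ∈ Finset.Icc (k + p + 1 + 1) (s + 1), (x (i - 1) - x i) * v i) / x (k + p + 1) := by
    rw [le_div_iff₀ hxj]
    linarith
  generalize (∑ i ∈ Finset.Icc (k + p + 1 + 1) (s + 1), (x (i - 1) - x i) * v i) /
    x (k + p + 1) = S at hC hT'
  simp only [Nat.add_sub_cancel] at hC hL
  have hdk := hd k hk (by omega)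
  have b1 := mul_le_mul hg he' hej.le hdk.le
  have b2 := mul_le_mul_of_nonneg_left hT' ha.le
  have hpos := mul_pos ha hej
  have key : β ^ p < (n : ℝ) / 2 + 1 := by
    refine lt_of_mul_lt_mul_right ?_ hpos.le
    linarith
  have hp : k + p + 1 - k - 1 = p := by omega
  rw [hp, ← hn]
  push_cast
  have : (0 : ℝ) ≤ p := by positivity
  linarith
end

section
/- Suppose the CTR sequence is convex: x_{i−1} − x_i ≥ x_i − x_{i+1} for all 2 ≤ i ≤ s (recall x_{s+1} = 0), and the valuation sequence is 2-convex including the extension v_{s+2} := 0: v_i − v_{i+1} ≥ 2·(v_{i+1} − v_{i+2}) for all 1 ≤ i ≤ s. Then for every pair 1 ≤ k < j−1 with j ≤ s+1, the pair-deviation condition C(k,j) fails, i.e. Σ_{t=k+1}^{j−1} (x_{t−1} − x_t)(v_k − v_t) ≥ a·v_j − a·Σ_{i=j+1}^{s+1} w_i v_i. (Hence only the s neighbor pairs can deviate from the Lower Equilibrium of GSP when valuations are β-convex with β ≥ 2.) -/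
/-- If CTRs are convex and valuations are `2`-convex (including the extension
`v_{s+2} := 0`), then the pair-deviation condition `C(k,j)` fails for every pair
`1 ≤ k < j−1` with `j ≤ s+1`; hence only the `s` neighbor pairs can deviate from the
Lower Equilibrium of GSP. -/
theorem two_convex_valuations_no_nonneighbor_pair_deviation
    (s : ℕ) (x v : ℕ → ℝ)
    (hs : 1 ≤ s)
    (hxdec : ∀ i, 1 ≤ i → i < s → x (i + 1) < x i)
    (hxpos : 0 < x s) (hxtop : x (s + 1) = 0)
    (hvdec : ∀ i, 1 ≤ i → i ≤ s → v (i + 1) < v i)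
    (hvpos : 0 < v (s + 1)) (hvtop : v (s + 2) = 0)
    (hxconv : ∀ i, 2 ≤ i → i ≤ s → x i - x (i + 1) ≤ x (i - 1) - x i)
    (hv2conv : ∀ i, 1 ≤ i → i ≤ s → 2 * (v (i + 1) - v (i + 2)) ≤ v i - v (i + 1)) :
    ∀ k j : ℕ, 1 ≤ k → k + 1 < j → j ≤ s + 1 →
      (x (j - 1) - x j) * v j -
          (x (j - 1) - x j) *
            ∑ i ∈ Finset.Icc (j + 1) (s + 1), ((x (i - 1) - x i) / x j) * v i ≤
        ∑ t ∈ Finset.Icc (k + 1) (j - 1), (x (t - 1) - x t) * (v k - v t) := by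
  have hx : ∀ i, 1 ≤ i → i ≤ s → x (i + 1) ≤ x i := by
    intro i h1 h2
    rcases h2.lt_or_eq with h | h
    · exact (hxdec i h1 h).le
    · subst h
      rw [hxtop]
      exact hxpos.le
  have hx0 : ∀ n i, i + n = s + 1 → 1 ≤ i → 0 ≤ x i := by
    intro n
    induction n with
    | zero =>
      intro i h _
      have h' : i = s + 1 := by omega
      rw [h', hxtop]
    | succ n ih =>
      intro i h h1
      exact (ih (i + 1) (by omega) (by omega)).trans (hx i h1 (by omega))
  have hv2 : ∀ n i, i + n = s + 1 → 1 ≤ i → 2 * v (i + 1) ≤ v i ∧ 0 < v i := by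
    intro n
    induction n with
    | zero =>
      intro i h _
      have h' : i = s + 1 := by omega
      subst h'
      rw [hvtop]
      exact ⟨by linarith, hvpos⟩
    | succ n ih =>
      intro i h h1
      have h3 := ih (i + 1) (by omega) (by omega)
      have h4 := hv2conv i h1 (by omega)
      have h5 : i + 1 + 1 = i + 2 := rfl
      rw [h5] at h3
      constructor <;> linarith [h3.1, h3.2]
  have hvanti : ∀ n k, 1 ≤ k → k + n ≤ s + 1 → v (k + n) ≤ v k := by
    intro n
    induction n with
    | zero => intro k _ _; exact le_rfl
    | succ n ih =>
      intro k h1 h2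
      exact (hvdec (k + n) (by omega) (by omega)).le.trans (ih k h1 (by omega))
  intro k j hk hkj hj
  obtain ⟨m, rfl⟩ : ∃ m, j = m + 2 := ⟨j - 2, by omega⟩
  have e1 : m + 2 - 1 = m + 1 := by omega
  rw [e1]
  have ha : 0 ≤ x (m + 1) - x (m + 2) := by
    have := hx (m + 1) (by omega) (by omega)
    exact sub_nonneg.2 this
  have hS : 0 ≤ ∑ i ∈ Finset.Icc (m + 2 + 1) (s + 1), ((x (i - 1) - x i) / x (m + 2)) * v i := by
    apply Finset.sum_nonneg
    intro i hi
    rw [Finset.mem_Icc] at hi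
    obtain ⟨p, rfl⟩ : ∃ p, i = p + 1 := ⟨i - 1, by omega⟩
    have h1 := hx p (by omega) (by omega)
    have h2 := (hv2 (s - p) (p + 1) (by omega) (by omega)).2
    have h3 := hx0 (s + 1 - (m + 2)) (m + 2) (by omega) (by omega)
    exact mul_nonneg (div_nonneg (sub_nonneg.2 h1) h3) h2.le
  have hT : (x (m + 1 - 1) - x (m + 1)) * (v k - v (m + 1)) ≤
      ∑ t ∈ Finset.Icc (k + 1) (m + 1), (x (t - 1) - x t) * (v k - v t) := by
    apply Finset.single_le_sum (f := fun t => (x (t - 1) - x t) * (v k - v t))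
    · intro t ht
      rw [Finset.mem_Icc] at ht
      obtain ⟨p, rfl⟩ : ∃ p, t = p + 1 := ⟨t - 1, by omega⟩
      have h1 := hx p (by omega) (by omega)
      have h2 := hvanti (p + 1 - k) k hk (by omega)
      rw [show k + (p + 1 - k) = p + 1 by omega] at h2
      exact mul_nonneg (sub_nonneg.2 h1) (sub_nonneg.2 h2)
    · rw [Finset.mem_Icc]; omega
  refine le_trans ?_ hT
  have hc := hxconv (m + 1) (by omega) (by omega)
  have hd : v (m + 2) ≤ v k - v (m + 1) := by
    have h1 := hvanti (m - k) k hk (by omega)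
    rw [show k + (m - k) = m by omega] at h1
    have h2 := (hv2 (s + 1 - m) m (by omega) (by omega)).1
    have h3 : v (m + 2) < v (m + 1) := hvdec (m + 1) (by omega) (by omega)
    linarith
  have hvm := (hv2 (s + 1 - (m + 2)) (m + 2) (by omega) (by omega)).2
  have h6 : (x (m + 1) - x (m + 2)) * v (m + 2) ≤
      (x (m + 1 - 1) - x (m + 1)) * (v k - v (m + 1)) :=
    mul_le_mul hc hd hvm.le (ha.trans hc)
  have h7 := mul_nonneg ha hS
  linarith
end

section
/- Suppose the CTR sequence is concave: x_{i−1} − x_i ≤ x_i − x_{i+1} for all 2 ≤ i ≤ s (recall x_{s+1} = 0), and the valuation sequence is concave: v_{i−1} − v_i ≤ v_i − v_{i+1} for all 2 ≤ i ≤ s. Let 1 ≤ k < j−1 with j ≤ s and set h = j − k − 1. If s − j ≥ h·(h+5), then the pair-deviation condition C(k,j) holds. (Hence Ω(s·√s) pairs can deviate from the Lower Equilibrium of GSP when CTRs and valuations are concave.) -/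
lemma diff_mono_aux (s : ℕ) (x : ℕ → ℝ)
    (hc : ∀ i, 2 ≤ i → i ≤ s → x (i - 1) - x i ≤ x i - x (i + 1))
    (p : ℕ) (hp : 1 ≤ p) (q : ℕ) (hpq : p ≤ q) (hq : q ≤ s) :
    x p - x (p + 1) ≤ x q - x (q + 1) := by
  induction q, hpq using Nat.le_induction with
  | base => exact le_rfl
  | succ q hpq ih =>
    have h1 := ih (by omega)
    have h2 := hc (q + 1) (by omega) hq
    simp only [Nat.add_sub_cancel] at h2
    linarith


/-- If CTRs and valuations are concave, then for every pair `1 ≤ k < j−1` with `j ≤ s`,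
writing `h = j − k − 1`, the condition `s − j ≥ h·(h+5)` implies that the pair-deviation
condition `C(k,j)` holds; hence `Ω(s·√s)` pairs can deviate from the Lower Equilibrium
of GSP. -/
theorem concave_pair_deviation_lower_bound
    (s : ℕ) (x v : ℕ → ℝ)
    (hs : 1 ≤ s)
    (hxdec : ∀ i, 1 ≤ i → i < s → x (i + 1) < x i)
    (hxpos : 0 < x s) (hxtop : x (s + 1) = 0)
    (hvdec : ∀ i, 1 ≤ i → i ≤ s → v (i + 1) < v i)
    (hvpos : 0 < v (s + 1))
    (hxconc : ∀ i, 2 ≤ i → i ≤ s → x (i - 1) - x i ≤ x i - x (i + 1))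
    (hvconc : ∀ i, 2 ≤ i → i ≤ s → v (i - 1) - v i ≤ v i - v (i + 1))
    (k j : ℕ) (hk : 1 ≤ k) (hkj : k + 1 < j) (hj : j ≤ s)
    (hfar : j + (j - k - 1) * (j - k - 1 + 5) ≤ s) :
    ∑ t ∈ Finset.Icc (k + 1) (j - 1), (x (t - 1) - x t) * (v k - v t) <
      (x (j - 1) - x j) * v j -
        (x (j - 1) - x j) *
          ∑ i ∈ Finset.Icc (j + 1) (s + 1), ((x (i - 1) - x i) / x j) * v i := by
  obtain ⟨h, rfl⟩ : ∃ h, j = k + h + 1 := ⟨j - k - 1, by omega⟩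
  have e1 : k + h + 1 - k - 1 = h := by omega
  rw [e1] at hfar
  obtain ⟨n, rfl⟩ : ∃ n, s = k + h + 1 + n := ⟨s - (k + h + 1), by omega⟩
  have hn : h * (h + 5) ≤ n := by omega
  have hx := diff_mono_aux _ x hxconc
  have hv := diff_mono_aux _ v hvconc
  simp only [Nat.add_sub_cancel]
  obtain ⟨j, hjd⟩ : ∃ j, j = k + h + 1 := ⟨_, rfl⟩
  obtain ⟨b, hb⟩ : ∃ b, b = v j - v (j + 1) := ⟨_, rfl⟩
  obtain ⟨a, ha⟩ : ∃ a, a = x (k + h) - x j := ⟨_, rfl⟩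
  have hbpos : 0 < b := by
    have := hvdec j (by omega) (by omega)
    linarith
  have hapos : 0 < a := by
    have := hxdec (k + h) (by omega) (by omega)
    rw [← hjd] at this
    linarith
  have hvk : ∀ m, m ≤ h → v k - v (k + m) ≤ m * b := by
    intro m
    induction m with
    | zero => simp
    | succ m ih =>
      intro hm
      have h1 := ih (by omega)
      have h2 := hv (k + m) (by omega) j (by omega) (by omega)
      push_cast
      rw [← add_assoc k m 1]
      linarith
  have hvj : ∀ m, m ≤ n + 1 → m * b ≤ v j - v (j + m) := by
    intro m
    induction m with
    | zero => simp
    | succ m ih =>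
      intro hm
      have h1 := ih (by omega)
      have h2 := hv j (by omega) (j + m) (by omega) (by omega)
      push_cast
      rw [← add_assoc j m 1]
      linarith
  have gauss : ∀ m : ℕ, ∑ i ∈ Finset.range m, ((i + 1 : ℕ) : ℝ) * b = m * (m + 1) / 2 * b := by
    intro m
    induction m with
    | zero => simp
    | succ m ih => rw [Finset.sum_range_succ, ih]; push_cast; ring
  have xpos : 0 < x j := by
    have h1 : x (j + (n + 1)) = 0 := by rw [← hxtop]; congr 1; omega
    have key : ∀ m, m ≤ n → x (j + m) ≤ x j := by
      intro m
      induction m with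
      | zero => simp
      | succ m ih =>
        intro hm
        have h1 := ih (by omega)
        have h2 := hxdec (j + m) (by omega) (by omega)
        rw [← add_assoc]
        linarith
    have h2 := key n le_rfl
    rw [hjd] at h2 ⊢
    linarith
  have hL : ∑ t ∈ Finset.Icc (k + 1) (k + h), (x (t - 1) - x t) * (v k - v t)
      ≤ a * (h * (h + 1) / 2 * b) := by
    rw [← Finset.Ico_add_one_right_eq_Icc, Finset.sum_Ico_eq_sum_range, ← gauss, Finset.mul_sum,
      show k + h + 1 - (k + 1) = h by omega]
    apply Finset.sum_le_sum
    intro m hm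
    have hm := Finset.mem_range.1 hm
    have h1 := hvk (m + 1) (by omega)
    have h2 := hx (k + m) (by omega) (k + h) (by omega) (by omega)
    have h3 := hv k hk
    rw [← hjd, ← ha] at h2
    rw [show k + 1 + m - 1 = k + m by omega, show k + 1 + m = k + m + 1 by omega]
    rw [← add_assoc] at h1
    have h4 : x (k + m + 1) < x (k + m) := hxdec _ (by omega) (by omega)
    calc _ ≤ (x (k + m) - x (k + m + 1)) * (((m + 1 : ℕ) : ℝ) * b) :=
          mul_le_mul_of_nonneg_left h1 (by linarith)
      _ ≤ _ := mul_le_mul_of_nonneg_right h2 (by positivity)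
  have hxs : ∑ m ∈ Finset.range (n + 1), (x (j + m) - x (j + m + 1)) = x j := by
    have := Finset.sum_range_sub' (fun m => x (j + m)) (n + 1)
    simp only [← add_assoc] at this
    rw [this, show j + n + 1 = k + h + 1 + n + 1 by omega, hxtop]
    simp
  have hcheb : (∑ m ∈ Finset.range (n + 1), (x (j + m) - x (j + m + 1))) *
      (∑ m ∈ Finset.range (n + 1), (v j - v (j + m + 1))) ≤
      ((Finset.range (n + 1)).card : ℝ) * ∑ m ∈ Finset.range (n + 1),
        (x (j + m) - x (j + m + 1)) * (v j - v (j + m + 1)) := by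
    apply MonovaryOn.sum_mul_sum_le_card_mul_sum
    apply MonotoneOn.monovaryOn
    · intro p hp q hq hpq
      simp only [Finset.coe_range, Set.mem_Iio] at hp hq
      exact hx (j + p) (by omega) (j + q) (by omega) (by omega)
    · intro p hp q hq hpq
      simp only [Finset.coe_range, Set.mem_Iio] at hp hq
      show v j - v (j + p + 1) ≤ v j - v (j + q + 1)
      clear hp
      induction q, hpq using Nat.le_induction with
      | base => exact le_rfl
      | succ q hpq ih =>
        have h1 := ih (by omega)
        have h2 := hvdec (j + q + 1) (by omega) (by omega)
        rw [← add_assoc j q 1]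
        linarith
  have hvs : ((n + 1 : ℕ) : ℝ) * (((n + 1 : ℕ) : ℝ) + 1) / 2 * b ≤
      ∑ m ∈ Finset.range (n + 1), (v j - v (j + m + 1)) := by
    rw [← gauss]
    apply Finset.sum_le_sum
    intro m hm
    have hm := Finset.mem_range.1 hm
    exact hvj (m + 1) (by omega)
  rw [hxs, Finset.card_range] at hcheb
  have hS : x j * (((n : ℝ) + 2) / 2 * b) ≤ ∑ m ∈ Finset.range (n + 1),
        (x (j + m) - x (j + m + 1)) * (v j - v (j + m + 1)) := by
    have hnp : (0 : ℝ) < ((n + 1 : ℕ) : ℝ) := by positivity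
    refine le_of_mul_le_mul_left ?_ hnp
    refine le_trans (le_of_eq ?_) (le_trans (mul_le_mul_of_nonneg_left hvs xpos.le) hcheb)
    push_cast
    ring
  have hR : ∑ i ∈ Finset.Icc (j + 1) (k + h + 1 + n + 1), ((x (i - 1) - x i) / x j) * v i
      = v j - (∑ m ∈ Finset.range (n + 1),
        (x (j + m) - x (j + m + 1)) * (v j - v (j + m + 1))) / x j := by
    rw [← Finset.Ico_add_one_right_eq_Icc, Finset.sum_Ico_eq_sum_range,
      show k + h + 1 + n + 1 + 1 - (j + 1) = n + 1 by omega]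
    have h1 : ∑ m ∈ Finset.range (n + 1), (x (j + m) - x (j + m + 1)) * (v j - v (j + m + 1))
        = x j * v j - ∑ m ∈ Finset.range (n + 1), (x (j + m) - x (j + m + 1)) * v (j + m + 1) := by
      simp only [mul_sub]
      rw [Finset.sum_sub_distrib, ← Finset.sum_mul, hxs]
    rw [h1, sub_div, mul_div_cancel_left₀ _ xpos.ne', sub_sub_cancel, Finset.sum_div]
    apply Finset.sum_congr rfl
    intro m _
    rw [show j + 1 + m - 1 = j + m by omega, show j + 1 + m = j + m + 1 by omega]
    ring
  rw [← hjd] at hR ⊢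
  rw [← ha, hR]
  have hS' := (le_div_iff₀' xpos).2 hS
  refine lt_of_le_of_lt hL ?_
  have hn' : (h : ℝ) * (h + 5) ≤ n := by exact_mod_cast hn
  have hh : (0 : ℝ) ≤ h := by positivity
  have h5 : (h : ℝ) * (h + 1) / 2 * b < ((n : ℝ) + 2) / 2 * b :=
    mul_lt_mul_of_pos_right (by nlinarith) hbpos
  rw [← mul_sub, sub_sub_cancel]
  exact mul_lt_mul_of_pos_left (lt_of_lt_of_le h5 hS') hapos
end

section
/- Suppose the CTR sequence is concave: x_{i−1} − x_i ≤ x_i − x_{i+1} for all 2 ≤ i ≤ s (recall x_{s+1} = 0), and the valuation sequence is 2-concave: v_{i+1} − v_{i+2} ≥ 2·(v_i − v_{i+1}) for all 1 ≤ i ≤ s−1. Then for every pair 1 ≤ k < j−1 with j ≤ s, the pair-deviation condition C(k,j) holds. (Hence when valuations are β-concave with β ≥ 2, all pairs of winners can deviate from the Lower Equilibrium of GSP.) -/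
theorem tele_aux (f : ℕ → ℝ) (a m : ℕ) (h : a ≤ m) :
    ∑ t ∈ Finset.Icc (a + 1) m, (f t - f (t + 1)) = f (a + 1) - f (m + 1) := by
  induction m, h using Nat.le_induction with
  | base => simp
  | succ m hm ih => rw [Finset.sum_Icc_succ_top (by omega), ih]; ring

theorem tele_aux2 (f : ℕ → ℝ) (a m : ℕ) (h : a ≤ m) :
    ∑ t ∈ Finset.Icc (a + 1) m, (f (t - 1) - f t) = f a - f m := by
  induction m, h using Nat.le_induction with
  | base => simp
  | succ m hm ih => rw [Finset.sum_Icc_succ_top (by omega), ih]; simp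


/-- If CTRs are concave and valuations are `2`-concave, then the pair-deviation
condition `C(k,j)` holds for every pair `1 ≤ k < j−1` with `j ≤ s`; hence all pairs of
winners can deviate from the Lower Equilibrium of GSP. -/
theorem two_concave_valuations_all_pairs_deviate
    (s : ℕ) (x v : ℕ → ℝ)
    (hs : 1 ≤ s)
    (hxdec : ∀ i, 1 ≤ i → i < s → x (i + 1) < x i)
    (hxpos : 0 < x s) (hxtop : x (s + 1) = 0)
    (hvdec : ∀ i, 1 ≤ i → i ≤ s → v (i + 1) < v i)
    (hvpos : 0 < v (s + 1))
    (hxconc : ∀ i, 2 ≤ i → i ≤ s → x (i - 1) - x i ≤ x i - x (i + 1))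
    (hv2conc : ∀ i, 1 ≤ i → i + 1 ≤ s → 2 * (v i - v (i + 1)) ≤ v (i + 1) - v (i + 2)) :
    ∀ k j : ℕ, 1 ≤ k → k + 1 < j → j ≤ s →
      ∑ t ∈ Finset.Icc (k + 1) (j - 1), (x (t - 1) - x t) * (v k - v t) <
        (x (j - 1) - x j) * v j -
          (x (j - 1) - x j) *
            ∑ i ∈ Finset.Icc (j + 1) (s + 1), ((x (i - 1) - x i) / x j) * v i := by
  intro k j hk hkj hjs
  have hx1 : ∀ i, 1 ≤ i → i ≤ s → x (i + 1) < x i := by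
    intro i h1 h2
    rcases Nat.lt_or_ge i s with h | h
    · exact hxdec i h1 h
    · have : i = s := by omega
      subst this
      rw [hxtop]; exact hxpos
  have hxp : ∀ i, i ≤ s → 1 ≤ i → 0 < x i := by
    intro i hi
    induction hi using Nat.decreasingInduction with
    | self => intro _; exact hxpos
    | of_succ i hi ih => intro h; exact (ih (by omega)).trans (hx1 i h (by omega))
  have hA : ∀ t, k ≤ t → t ≤ s → v k - v t ≤ v t - v (t + 1) := by
    intro t ht
    induction t, ht using Nat.le_induction with
    | base => intro h; linarith [hvdec k hk h]
    | succ t ht ih =>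
      intro h
      have h1 := ih (by omega)
      have h2 := hv2conc t (by omega) h
      have : t + 1 + 1 = t + 2 := rfl
      rw [this]; linarith
  have hd : ∀ t, 2 ≤ t → ∀ m, t ≤ m → m ≤ s → x (t - 1) - x t ≤ x (m - 1) - x m := by
    intro t ht m hm
    induction m, hm using Nat.le_induction with
    | base => intro _; exact le_rfl
    | succ m hm ih =>
      intro h
      have h1 := ih (by omega)
      have h2 := hxconc m (by omega) (by omega)
      simpa using h1.trans h2
  have hv : ∀ i, j + 1 ≤ i → i ≤ s + 1 → v i ≤ v (j + 1) := by
    intro i hi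
    induction i, hi using Nat.le_induction with
    | base => intro _; exact le_rfl
    | succ i hi ih =>
      intro h
      linarith [ih (by omega), hvdec i (by omega) (by omega)]
  have hxj := hxp j hjs (by omega)
  have ha : 0 < x (j - 1) - x j := by
    have := hx1 (j - 1) (by omega) (by omega)
    rw [Nat.sub_add_cancel (by omega)] at this
    linarith
  have hR : ∑ i ∈ Finset.Icc (j + 1) (s + 1), ((x (i - 1) - x i) / x j) * v i ≤ v (j + 1) := by
    calc _ ≤ ∑ i ∈ Finset.Icc (j + 1) (s + 1), (x (i - 1) - x i) * (v (j + 1) / x j) := by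
          apply Finset.sum_le_sum
          intro i hi
          rw [Finset.mem_Icc] at hi
          have h1 := hx1 (i - 1) (by omega) (by omega)
          rw [Nat.sub_add_cancel (by omega)] at h1
          have h2 : 0 ≤ (x (i - 1) - x i) / x j := div_nonneg (by linarith) hxj.le
          calc _ ≤ (x (i - 1) - x i) / x j * v (j + 1) :=
                mul_le_mul_of_nonneg_left (hv i hi.1 hi.2) h2
            _ = _ := by ring
      _ = v (j + 1) := by
          rw [← Finset.sum_mul, tele_aux2 x j (s + 1) (by omega), hxtop]
          field_simp
          ring
  have hL : ∑ t ∈ Finset.Icc (k + 1) (j - 1), (x (t - 1) - x t) * (v k - v t) ≤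
      (x (j - 1) - x j) * (v (k + 1) - v j) := by
    have ht := tele_aux v k (j - 1) (by omega)
    rw [Nat.sub_add_cancel (by omega)] at ht
    rw [← ht, Finset.mul_sum]
    apply Finset.sum_le_sum
    intro t hi
    rw [Finset.mem_Icc] at hi
    have h1 := hd t (by omega) j (by omega) hjs
    have h2 := hA t (by omega) (by omega)
    have h3 := hvdec t (by omega) (by omega)
    have h4 := hx1 (t - 1) (by omega) (by omega)
    rw [Nat.sub_add_cancel (by omega)] at h4
    calc _ ≤ (x (t - 1) - x t) * (v t - v (t + 1)) :=
          mul_le_mul_of_nonneg_left h2 (by linarith)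
      _ ≤ _ := mul_le_mul_of_nonneg_right h1 (by linarith)
  refine hL.trans_lt ?_
  rw [← mul_sub]
  apply mul_lt_mul_of_pos_left _ ha
  linarith [hA j (by omega) hjs, hvdec k hk (by omega)]
end

section
/- In the truthful outcome of VCG, every potential coalition has a weak deviation. Precisely: let R ⊆ {1, …, s+1} be nonempty with either R ⊆ {1, …, s} and |R| ≥ 2, or s+1 ∈ R and R ∩ {1, …, s} ≠ ∅. Define reports b_i = (v_i + v_{i+1})/2 for i ∈ R and b_i = v_i for i ∉ R. Then b_1 > b_2 > ⋯ > b_n (so the slot allocation is unchanged); every bidder i ∈ R with i ≥ s+1 has utility 0 under both b and truthful reports; every bidder i ∈ R with i ≤ s has utility under b at least her truthful utility, with strict inequality if and only if R ∩ {i+1, …, s+1} ≠ ∅; and at least one member of R strictly gains. -/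
/-- Utility of bidder `i` in the VCG ad auction with `s` slots, CTRs `x`, valuations
`v`, given strictly decreasing reports `r`: bidder `i ≤ s` is allocated slot `i` and
pays per click `p_i(r) = Σ_{j=i+1}^{s+1} ((x_{j−1} − x_j)/x_i)·r_j`, obtaining
`(v_i − p_i(r))·x_i`; bidders `i > s` get no slot and utility `0`. -/
noncomputable def vcgUtil (s : ℕ) (x v : ℕ → ℝ) (r : ℕ → ℝ) (i : ℕ) : ℝ :=
  if i ≤ s then
    (v i - ∑ j ∈ Finset.Icc (i + 1) (s + 1), ((x (j - 1) - x j) / x i) * r j) * x i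
  else 0

/-- In the truthful outcome of VCG, every potential coalition has a weak deviation:
for a potential coalition `R` (either `R ⊆ {1,…,s}` with `|R| ≥ 2`, or `s+1 ∈ R` and
`R` contains a winner), the reports `b_i = (v_i + v_{i+1})/2` for `i ∈ R`, `b_i = v_i`
otherwise, are strictly decreasing (so the allocation is unchanged); members of `R`
ranked `≥ s+1` get utility `0` under both profiles; members `i ≤ s` of `R` weakly gain,
strictly iff some member of `R` is in `{i+1,…,s+1}`; and some member of `R` strictly
gains. -/
theorem vcg_truthful_every_potential_coalition_deviates
    (s n : ℕ) (x v b : ℕ → ℝ)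
    (hs : 1 ≤ s) (hn : s + 2 ≤ n)
    (hxdec : ∀ j, 1 ≤ j → j < s → x (j + 1) < x j)
    (hxpos : 0 < x s)
    (hx0 : ∀ j, s < j → x j = 0)
    (hvdec : ∀ i, 1 ≤ i → i < n → v (i + 1) < v i)
    (hvpos : 0 < v n)
    (R : Finset ℕ) (hR : R ⊆ Finset.Icc 1 (s + 1)) (hRne : R.Nonempty)
    (hRpot : (R ⊆ Finset.Icc 1 s ∧ 2 ≤ R.card) ∨
      (s + 1 ∈ R ∧ (R ∩ Finset.Icc 1 s).Nonempty))
    (hb : ∀ i, b i = if i ∈ R then (v i + v (i + 1)) / 2 else v i) :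
    (∀ i, 1 ≤ i → i < n → b (i + 1) < b i) ∧
    (∀ i ∈ R, s + 1 ≤ i → vcgUtil s x v b i = 0 ∧ vcgUtil s x v v i = 0) ∧
    (∀ i ∈ R, i ≤ s →
      vcgUtil s x v v i ≤ vcgUtil s x v b i ∧
      (vcgUtil s x v v i < vcgUtil s x v b i ↔
        (R ∩ Finset.Icc (i + 1) (s + 1)).Nonempty)) ∧
    (∃ i ∈ R, vcgUtil s x v v i < vcgUtil s x v b i) := by
  have hxp : ∀ k, k < s → 0 < x (s - k) := by
    intro k
    induction k with
    | zero => intro _; simpa using hxpos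
    | succ k ih =>
      intro hk
      have h1 := ih (by omega)
      have h2 := hxdec (s - (k + 1)) (by omega) (by omega)
      rw [show s - (k + 1) + 1 = s - k by omega] at h2
      linarith
  have hxpos' : ∀ i, 1 ≤ i → i ≤ s → 0 < x i := by
    intro i h1 h2
    have := hxp (s - i) (by omega)
    rwa [show s - (s - i) = i by omega] at this
  have hd : ∀ j, 2 ≤ j → j ≤ s + 1 → 0 < x (j - 1) - x j := by
    intro j h1 h2
    rcases Nat.lt_or_ge s j with h | h
    · rw [hx0 j h, show j - 1 = s by omega]
      linarith
    · have h3 := hxdec (j - 1) (by omega) (by omega)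
      rw [show j - 1 + 1 = j by omega] at h3
      linarith
  have hRb : ∀ j ∈ R, 1 ≤ j ∧ j ≤ s + 1 := fun j hj => Finset.mem_Icc.mp (hR hj)
  have hbR : ∀ j ∈ R, v (j + 1) < b j ∧ b j < v j := by
    intro j hj
    have h1 := hRb j hj
    have h2 := hvdec j h1.1 (by omega)
    rw [hb j, if_pos hj]
    constructor <;> linarith
  have hbN : ∀ j, j ∉ R → b j = v j := by
    intro j hj
    rw [hb j, if_neg hj]
  have hble : ∀ j, b j ≤ v j := by
    intro j
    by_cases hj : j ∈ R
    · exact (hbR j hj).2.le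
    · exact (hbN j hj).le
  have hU : ∀ i, 1 ≤ i → i ≤ s → vcgUtil s x v b i - vcgUtil s x v v i =
      ∑ j ∈ Finset.Icc (i + 1) (s + 1), (x (j - 1) - x j) * (v j - b j) := by
    intro i h1 h2
    have hx := (hxpos' i h1 h2).ne'
    unfold vcgUtil
    rw [if_pos h2, if_pos h2, ← sub_mul, sub_sub_sub_cancel_left, ← Finset.sum_sub_distrib,
      Finset.sum_mul]
    refine Finset.sum_congr rfl fun j _ => ?_
    field_simp
  have hnn : ∀ i, 1 ≤ i → ∀ j ∈ Finset.Icc (i + 1) (s + 1),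
      0 ≤ (x (j - 1) - x j) * (v j - b j) := by
    intro i h1 j hj
    rw [Finset.mem_Icc] at hj
    exact mul_nonneg (hd j (by omega) hj.2).le (sub_nonneg.mpr (hble j))
  have main : ∀ i ∈ R, i ≤ s →
      vcgUtil s x v v i ≤ vcgUtil s x v b i ∧
      (vcgUtil s x v v i < vcgUtil s x v b i ↔
        (R ∩ Finset.Icc (i + 1) (s + 1)).Nonempty) := by
    intro i hi his
    have h1 := (hRb i hi).1
    rw [← sub_nonneg, ← sub_pos, hU i h1 his]
    refine ⟨Finset.sum_nonneg (hnn i h1), ?_, ?_⟩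
    · intro h
      by_contra hne
      rw [Finset.not_nonempty_iff_eq_empty] at hne
      have : ∑ j ∈ Finset.Icc (i + 1) (s + 1), (x (j - 1) - x j) * (v j - b j) = 0 := by
        refine Finset.sum_eq_zero fun j hj => ?_
        have hjR : j ∉ R := fun hjR => by
          have := Finset.mem_inter.mpr ⟨hjR, hj⟩
          rw [hne] at this
          simp at this
        rw [hbN j hjR, sub_self, mul_zero]
      linarith
    · rintro ⟨j, hj⟩
      rw [Finset.mem_inter] at hj
      refine Finset.sum_pos' (hnn i h1) ⟨j, hj.2, ?_⟩
      have h3 := Finset.mem_Icc.mp hj.2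
      exact mul_pos (hd j (by omega) h3.2) (sub_pos.mpr (hbR j hj.1).2)
  refine ⟨?_, ?_, main, ?_⟩
  · intro i h1 h2
    have h3 := hvdec i h1 h2
    have h4 := hble (i + 1)
    by_cases hi : i ∈ R
    · linarith [(hbR i hi).1]
    · linarith [hbN i hi]
  · intro i _ h
    unfold vcgUtil
    rw [if_neg (by omega), if_neg (by omega)]
    exact ⟨rfl, rfl⟩
  · have key : ∃ i ∈ R, ∃ j ∈ R, i < j := by
      rcases hRpot with ⟨_, hc⟩ | ⟨hm, ⟨i, hi⟩⟩
      · obtain ⟨i, hi, j, hj, hij⟩ := Finset.one_lt_card.mp hc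
        rcases lt_or_gt_of_ne hij with h | h
        · exact ⟨i, hi, j, hj, h⟩
        · exact ⟨j, hj, i, hi, h⟩
      · rw [Finset.mem_inter, Finset.mem_Icc] at hi
        exact ⟨i, hi.1, s + 1, hm, by omega⟩
    obtain ⟨i, hi, j, hj, hij⟩ := key
    have hj' := hRb j hj
    exact ⟨i, hi, (main i hi (by omega)).2.mpr
      ⟨j, Finset.mem_inter.mpr ⟨hj, Finset.mem_Icc.mpr ⟨hij, hj'.2⟩⟩⟩⟩
end

section
/- Truth-telling is a super-strong equilibrium of the VCG auction with a random reserve price when there are at least as many slots as bidders: there is no nonempty coalition R ⊆ {1,…,n} and report vector b' with pairwise distinct entries satisfying b'_i = v_i for all i ∉ R, such that every member of R has expected utility under b' at least her expected utility under truthful reports and at least one member of R has strictly greater expected utility. -/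
/-- Given a finite set `S` of bidders with pairwise distinct reports `b`, the `t`-th
highest surviving report `b^{(t)}` (for distinct reports, the filter below has exactly
one element when `1 ≤ t ≤ |S|`, so the sum equals that report). -/
noncomputable def kthHighestBid (S : Finset ℕ) (b : ℕ → ℝ) (t : ℕ) : ℝ :=
  ∑ i ∈ S.filter (fun i => (S.filter (fun j => b i < b j)).card + 1 = t), b i

/-- Utility of bidder `i` in the VCG auction with reserve price `c`, given pairwise
distinct reports `b`: the survivor set is `S = {i ∈ {1,…,n} : b_i > c}`; ordering the
survivors by decreasing report, the `r`-th ranked survivor is allocated slot `r` and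
pays per click
`p_r = (1/x_r)·(Σ_{t=r+1}^{|S|} (x_{t−1} − x_t)·b^{(t)} + x_{|S|}·c)`,
obtaining utility `(v_i − p_r)·x_r`; non-survivors get utility `0`. -/
noncomputable def vcgReserveUtil (n : ℕ) (x v : ℕ → ℝ) (b : ℕ → ℝ) (c : ℝ) (i : ℕ) : ℝ :=
  if i ∈ (Finset.Icc 1 n).filter (fun j => c < b j) then
    (v i -
        (1 / x ((((Finset.Icc 1 n).filter (fun j => c < b j)).filter
            (fun j => b i < b j)).card + 1)) *
          ((∑ t ∈ Finset.Icc
              ((((Finset.Icc 1 n).filter (fun j => c < b j)).filter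
                  (fun j => b i < b j)).card + 2)
              ((Finset.Icc 1 n).filter (fun j => c < b j)).card,
              (x (t - 1) - x t) *
                kthHighestBid ((Finset.Icc 1 n).filter (fun j => c < b j)) b t) +
            x ((Finset.Icc 1 n).filter (fun j => c < b j)).card * c)) *
      x ((((Finset.Icc 1 n).filter (fun j => c < b j)).filter
          (fun j => b i < b j)).card + 1)
  else 0

/-- survivors -/
noncomputable def survSet (n : ℕ) (b : ℕ → ℝ) (c : ℝ) : Finset ℕ :=
  (Finset.Icc 1 n).filter (fun j => c < b j)

/-- order statistic padded by the reserve price -/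
noncomputable def padBid (n : ℕ) (b : ℕ → ℝ) (c : ℝ) (t : ℕ) : ℝ :=
  if t ≤ (survSet n b c).card then kthHighestBid (survSet n b c) b t else c

lemma exists_kth (S : Finset ℕ) (b : ℕ → ℝ)
    (hb : ∀ i ∈ S, ∀ j ∈ S, i ≠ j → b i ≠ b j) (t : ℕ) (ht : 1 ≤ t) (htS : t ≤ S.card) :
    ∃ i ∈ S, (S.filter (fun j => b i < b j)).card + 1 = t ∧ kthHighestBid S b t = b i := by
  have hlt : ∀ i ∈ S, ∀ j ∈ S, b i < b j →
      (S.filter (fun k => b j < b k)).card < (S.filter (fun k => b i < b k)).card := by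
    intro i hi j hj hij
    apply Finset.card_lt_card
    rw [Finset.ssubset_iff_of_subset]
    · exact ⟨j, by simp [hj, hij], by simp⟩
    · intro k hk
      simp only [Finset.mem_filter] at hk ⊢
      exact ⟨hk.1, hij.trans hk.2⟩
  have hinj : Set.InjOn (fun i => (S.filter (fun k => b i < b k)).card) S := by
    intro i hi j hj hij
    by_contra hne
    simp only at hij
    rcases lt_or_gt_of_ne (hb i hi j hj hne) with h | h
    · have := hlt i hi j hj h; omega
    · have := hlt j hj i hi h; omega
  have himg : S.image (fun i => (S.filter (fun k => b i < b k)).card) = Finset.range S.card := by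
    apply Finset.eq_of_subset_of_card_le
    · intro m hm
      simp only [Finset.mem_image] at hm
      obtain ⟨i, hi, rfl⟩ := hm
      rw [Finset.mem_range]
      apply Finset.card_lt_card
      rw [Finset.ssubset_iff_of_subset (Finset.filter_subset _ _)]
      exact ⟨i, hi, by simp⟩
    · rw [Finset.card_image_of_injOn hinj, Finset.card_range]
  have hmem : t - 1 ∈ S.image (fun i => (S.filter (fun k => b i < b k)).card) := by
    rw [himg, Finset.mem_range]; omega
  obtain ⟨i, hi, hit⟩ := Finset.mem_image.1 hmem
  have hit' : (S.filter (fun k => b i < b k)).card + 1 = t := by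
    omega
  refine ⟨i, hi, hit', ?_⟩
  unfold kthHighestBid
  have : S.filter (fun i => (S.filter (fun j => b i < b j)).card + 1 = t) = {i} := by
    ext j
    simp only [Finset.mem_filter, Finset.mem_singleton]
    constructor
    · rintro ⟨hj, hjt⟩
      apply hinj hj hi
      simp only
      omega
    · rintro rfl; exact ⟨hi, hit'⟩
  rw [this, Finset.sum_singleton]

lemma surv_inj {n : ℕ} {b : ℕ → ℝ} (c : ℝ)
    (hb : ∀ i ∈ Finset.Icc 1 n, ∀ j ∈ Finset.Icc 1 n, i ≠ j → b i ≠ b j) :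
    ∀ i ∈ survSet n b c, ∀ j ∈ survSet n b c, i ≠ j → b i ≠ b j :=
  fun i hi j hj => hb i (Finset.mem_filter.1 hi).1 j (Finset.mem_filter.1 hj).1

lemma padBid_ge {n : ℕ} {b : ℕ → ℝ} (c : ℝ)
    (hb : ∀ i ∈ Finset.Icc 1 n, ∀ j ∈ Finset.Icc 1 n, i ≠ j → b i ≠ b j)
    (t : ℕ) (ht : 1 ≤ t) : c ≤ padBid n b c t := by
  unfold padBid
  split_ifs with h
  · obtain ⟨i, hi, -, h2⟩ := exists_kth _ b (surv_inj c hb) t ht h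
    rw [h2]
    exact (Finset.mem_filter.1 hi).2.le
  · exact le_rfl

lemma lt_padBid_iff {n : ℕ} {b : ℕ → ℝ} (c : ℝ)
    (hb : ∀ i ∈ Finset.Icc 1 n, ∀ j ∈ Finset.Icc 1 n, i ≠ j → b i ≠ b j)
    (t : ℕ) (ht : 1 ≤ t) (z : ℝ) (hz : c ≤ z) :
    z < padBid n b c t ↔ t ≤ (survSet n b z).card := by
  unfold padBid
  have hsub : survSet n b z ⊆ survSet n b c := by
    intro j hj
    simp only [survSet, Finset.mem_filter] at hj ⊢
    exact ⟨hj.1, hz.trans_lt hj.2⟩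
  split_ifs with h
  · obtain ⟨i, hi, h1, h2⟩ := exists_kth _ b (surv_inj c hb) t ht h
    rw [h2]
    constructor
    · intro hzi
      rw [← h1, Nat.succ_le_iff]
      apply Finset.card_lt_card
      rw [Finset.ssubset_iff_of_subset]
      · refine ⟨i, ?_, by simp⟩
        simp only [survSet, Finset.mem_filter] at hi ⊢
        exact ⟨hi.1, hzi⟩
      · intro k hk
        simp only [survSet, Finset.mem_filter] at hk ⊢
        exact ⟨hk.1.1, hzi.trans hk.2⟩
    · intro hcard
      by_contra hzi
      push Not at hzi
      have : survSet n b z ⊆ (survSet n b c).filter (fun j => b i < b j) := by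
        intro k hk
        have hk2 := hsub hk
        simp only [survSet, Finset.mem_filter] at hk hk2 ⊢
        exact ⟨hk2, hzi.trans_lt hk.2⟩
      have := Finset.card_le_card this
      omega
  · constructor
    · intro h2; exact absurd h2 (not_lt.2 hz)
    · intro h2
      exact absurd (h2.trans (Finset.card_le_card hsub)) h

/-- rank of bidder -/
noncomputable def rankOf (n : ℕ) (b : ℕ → ℝ) (c : ℝ) (i : ℕ) : ℕ :=
  ((survSet n b c).filter (fun j => b i < b j)).card + 1

lemma rank_eq {n : ℕ} {b : ℕ → ℝ} {c : ℝ} {i : ℕ} (hi : c < b i) :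
    rankOf n b c i = (survSet n b (b i)).card + 1 := by
  unfold rankOf survSet
  congr 2
  ext j
  simp only [Finset.mem_filter]
  constructor
  · rintro ⟨⟨h1, _⟩, h3⟩; exact ⟨h1, h3⟩
  · rintro ⟨h1, h3⟩; exact ⟨⟨h1, hi.trans h3⟩, h3⟩

lemma rankOf_le_card {n : ℕ} {b : ℕ → ℝ} {c : ℝ} {i : ℕ} (hin : i ∈ Finset.Icc 1 n) (hi : c < b i)
    (z : ℝ) (hz : z < b i) : rankOf n b c i ≤ (survSet n b z).card := by
  rw [rank_eq hi, Nat.succ_le_iff]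
  apply Finset.card_lt_card
  rw [Finset.ssubset_iff_of_subset]
  · exact ⟨i, by simp only [survSet, Finset.mem_filter]; exact ⟨hin, hz⟩, by simp [survSet]⟩
  · intro k hk
    simp only [survSet, Finset.mem_filter] at hk ⊢
    exact ⟨hk.1, hz.trans hk.2⟩

lemma padBid_lt {n : ℕ} {b : ℕ → ℝ} {c : ℝ}
    (hb : ∀ i ∈ Finset.Icc 1 n, ∀ j ∈ Finset.Icc 1 n, i ≠ j → b i ≠ b j)
    {i : ℕ} (hi : c < b i) (t : ℕ) (ht : rankOf n b c i ≤ t) :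
    padBid n b c (t + 1) < b i := by
  unfold padBid
  split_ifs with h
  · obtain ⟨j, hj, h1, h2⟩ := exists_kth _ b (surv_inj c hb) (t + 1) (by omega) h
    rw [h2]
    by_contra hle
    push Not at hle
    have : (survSet n b c).filter (fun k => b j < b k) ⊆
        (survSet n b c).filter (fun k => b i < b k) := by
      intro k hk
      simp only [Finset.mem_filter] at hk ⊢
      exact ⟨hk.1, hle.trans_lt hk.2⟩
    have := Finset.card_le_card this
    unfold rankOf at ht
    omega
  · exact hi

/-- layer weights -/
noncomputable def layerW (n : ℕ) (x : ℕ → ℝ) (t : ℕ) : ℝ :=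
  (if t ≤ n then x t else 0) - (if t + 1 ≤ n then x (t + 1) else 0)

lemma sum_layerW (n : ℕ) (x : ℕ → ℝ) (k : ℕ) (hk : k ≤ n) :
    ∑ t ∈ Finset.Ico k (n + 1), layerW n x t = x k := by
  unfold layerW
  have := Finset.sum_Ico_sub (fun t => if t ≤ n then x t else 0) (show k ≤ n + 1 by omega)
  have h2 : ∑ t ∈ Finset.Ico k (n + 1),
      ((if t ≤ n then x t else 0) - (if t + 1 ≤ n then x (t + 1) else 0)) =
      - ∑ t ∈ Finset.Ico k (n + 1),
      ((if t + 1 ≤ n then x (t + 1) else 0) - (if t ≤ n then x t else 0)) := by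
    rw [← Finset.sum_neg_distrib]
    exact Finset.sum_congr rfl (fun t _ => by ring)
  rw [h2, this]
  simp [hk]

lemma util_eq {n : ℕ} {x v b : ℕ → ℝ} {c : ℝ} {i : ℕ}
    (hin : i ∈ Finset.Icc 1 n) (hi : c < b i) (hx : ∀ j, 1 ≤ j → j ≤ n → 0 < x j) :
    vcgReserveUtil n x v b c i =
      ∑ t ∈ Finset.Ico (rankOf n b c i) (n + 1),
        layerW n x t * (v i - padBid n b c (t + 1)) := by
  unfold vcgReserveUtil
  rw [if_pos (by simp only [Finset.mem_filter]; exact ⟨hin, hi⟩)]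
  change (v i - (1 / x (rankOf n b c i)) * ((∑ t ∈ Finset.Icc (rankOf n b c i + 1)
    (survSet n b c).card, (x (t - 1) - x t) * kthHighestBid (survSet n b c) b t) +
      x (survSet n b c).card * c)) * x (rankOf n b c i) = _
  have hrm : rankOf n b c i ≤ (survSet n b c).card := rankOf_le_card hin hi c hi
  have hr1 : 1 ≤ rankOf n b c i := by unfold rankOf; omega
  have hmn : (survSet n b c).card ≤ n := by
    have := Finset.card_le_card (Finset.filter_subset (fun j => c < b j) (Finset.Icc 1 n))
    simpa [survSet] using this
  have hpad1 : ∀ t, t ≤ (survSet n b c).card →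
      padBid n b c t = kthHighestBid (survSet n b c) b t := fun t ht => by
    unfold padBid; rw [if_pos ht]
  have hpad2 : ∀ t, ¬ t ≤ (survSet n b c).card → padBid n b c t = c := fun t ht => by
    unfold padBid; rw [if_neg ht]
  generalize rankOf n b c i = r at *
  generalize kthHighestBid (survSet n b c) b = K at *
  generalize (survSet n b c).card = m at *
  have hxr : x r ≠ 0 := (hx r hr1 (by omega)).ne'
  have e1 : ∑ t ∈ Finset.Ico r (n + 1), layerW n x t * (v i - padBid n b c (t + 1)) =
      x r * v i - ∑ t ∈ Finset.Ico r (n + 1), layerW n x t * padBid n b c (t + 1) := by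
    rw [← sum_layerW n x r (by omega), Finset.sum_mul, ← Finset.sum_sub_distrib]
    exact Finset.sum_congr rfl (fun t _ => by ring)
  have e2 : ∑ t ∈ Finset.Ico m (n + 1), layerW n x t * padBid n b c (t + 1) = x m * c := by
    rw [← sum_layerW n x m (by omega), Finset.sum_mul]
    refine Finset.sum_congr rfl (fun t ht => ?_)
    rw [Finset.mem_Ico] at ht
    rw [hpad2 _ (by omega)]
  have e3 : ∑ t ∈ Finset.Ico r m, layerW n x t * padBid n b c (t + 1) =
      ∑ t ∈ Finset.Icc (r + 1) m, (x (t - 1) - x t) * K t := by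
    have : Finset.Icc (r + 1) m = Finset.Ico (r + 1) (m + 1) := by
      ext t; simp only [Finset.mem_Icc, Finset.mem_Ico]; omega
    rw [this, ← Finset.sum_Ico_add' (fun t => (x (t - 1) - x t) * K t) r m 1]
    refine Finset.sum_congr rfl (fun t ht => ?_)
    rw [Finset.mem_Ico] at ht
    rw [hpad1 _ (by omega)]
    unfold layerW
    rw [if_pos (by omega), if_pos (by omega)]
    simp
  rw [e1, ← Finset.sum_Ico_consecutive _ hrm (show m ≤ n + 1 by omega), e2, e3]
  field_simp

lemma util_zero {n : ℕ} {x v b : ℕ → ℝ} {c : ℝ} {i : ℕ} (hi : ¬ c < b i) :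
    vcgReserveUtil n x v b c i = 0 := by
  unfold vcgReserveUtil
  rw [if_neg]
  simp only [Finset.mem_filter]
  tauto

lemma truth_eq {n : ℕ} {x v : ℕ → ℝ} {c : ℝ} {i : ℕ}
    (hv : ∀ i ∈ Finset.Icc 1 n, ∀ j ∈ Finset.Icc 1 n, i ≠ j → v i ≠ v j)
    (hin : i ∈ Finset.Icc 1 n) (hx : ∀ j, 1 ≤ j → j ≤ n → 0 < x j) :
    vcgReserveUtil n x v v c i =
      ∑ t ∈ Finset.Ico 1 (n + 1), layerW n x t * max (v i - padBid n v c (t + 1)) 0 := by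
  by_cases hi : c < v i
  · rw [util_eq hin hi hx]
    have hr1 : 1 ≤ rankOf n v c i := by unfold rankOf; omega
    have hrm : rankOf n v c i ≤ n + 1 := by
      have h1 : rankOf n v c i ≤ (survSet n v c).card := rankOf_le_card hin hi c hi
      have := Finset.card_le_card (Finset.filter_subset (fun j => c < v j) (Finset.Icc 1 n))
      have h2 : (survSet n v c).card ≤ n := by simpa [survSet] using this
      omega
    rw [← Finset.sum_Ico_consecutive _ hr1 hrm]
    have z : ∑ t ∈ Finset.Ico 1 (rankOf n v c i),
        layerW n x t * max (v i - padBid n v c (t + 1)) 0 = 0 := by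
      refine Finset.sum_eq_zero (fun t ht => ?_)
      rw [Finset.mem_Ico] at ht
      have : v i ≤ padBid n v c (t + 1) := by
        by_contra h
        push Not at h
        have h1 := rankOf_le_card hin hi _ h
        have := (lt_padBid_iff c hv (t + 1) (by omega) _
          (padBid_ge c hv (t + 1) (by omega))).2 (by omega)
        exact lt_irrefl _ this
      rw [max_eq_right (by linarith), mul_zero]
    rw [z, zero_add]
    refine Finset.sum_congr rfl (fun t ht => ?_)
    rw [Finset.mem_Ico] at ht
    have := padBid_lt hv hi t ht.1
    rw [max_eq_left (by linarith)]
  · rw [util_zero hi]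
    symm
    refine Finset.sum_eq_zero (fun t ht => ?_)
    have := padBid_ge c hv (t + 1) (by omega)
    rw [max_eq_right (by linarith), mul_zero]

lemma layerW_pos {n : ℕ} {x : ℕ → ℝ} (hx : ∀ j, 1 ≤ j → j ≤ n → 0 < x j)
    (hd : ∀ j, 1 ≤ j → j < n → x (j + 1) < x j) (t : ℕ) (h1 : 1 ≤ t) (h2 : t ≤ n) :
    0 < layerW n x t := by
  unfold layerW
  rw [if_pos h2]
  split_ifs with h
  · linarith [hd t h1 h]
  · linarith [hx t h1 h2]

lemma truth_nonneg {n : ℕ} {x v : ℕ → ℝ} {c : ℝ} {i : ℕ}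
    (hv : ∀ i ∈ Finset.Icc 1 n, ∀ j ∈ Finset.Icc 1 n, i ≠ j → v i ≠ v j)
    (hin : i ∈ Finset.Icc 1 n) (hx : ∀ j, 1 ≤ j → j ≤ n → 0 < x j)
    (hd : ∀ j, 1 ≤ j → j < n → x (j + 1) < x j) :
    0 ≤ vcgReserveUtil n x v v c i := by
  rw [truth_eq hv hin hx]
  refine Finset.sum_nonneg (fun t ht => ?_)
  rw [Finset.mem_Ico] at ht
  exact mul_nonneg (layerW_pos hx hd t ht.1 (by omega)).le (le_max_right _ _)

lemma truth_pos {n : ℕ} {x v : ℕ → ℝ} {c : ℝ} {i : ℕ} (hn : 1 ≤ n)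
    (hv : ∀ i ∈ Finset.Icc 1 n, ∀ j ∈ Finset.Icc 1 n, i ≠ j → v i ≠ v j)
    (hin : i ∈ Finset.Icc 1 n) (hx : ∀ j, 1 ≤ j → j ≤ n → 0 < x j)
    (hd : ∀ j, 1 ≤ j → j < n → x (j + 1) < x j) (hi : c < v i) :
    0 < vcgReserveUtil n x v v c i := by
  rw [truth_eq hv hin hx]
  refine Finset.sum_pos' (fun t ht => ?_) ⟨n, by simp [hn], ?_⟩
  · rw [Finset.mem_Ico] at ht
    exact mul_nonneg (layerW_pos hx hd t ht.1 (by omega)).le (le_max_right _ _)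
  · apply mul_pos (layerW_pos hx hd n hn le_rfl)
    apply lt_max_of_lt_left
    have hle : padBid n v c (n + 1) ≤ c := by
      by_contra h
      push Not at h
      have h1 := (lt_padBid_iff c hv (n + 1) (by omega) c le_rfl).1 h
      have := Finset.card_le_card (Finset.filter_subset (fun j => c < v j) (Finset.Icc 1 n))
      have h2 : (survSet n v c).card ≤ n := by simpa [survSet] using this
      omega
    linarith

lemma dev_le {n : ℕ} {x v b : ℕ → ℝ} {c : ℝ} {i : ℕ}
    (hv : ∀ i ∈ Finset.Icc 1 n, ∀ j ∈ Finset.Icc 1 n, i ≠ j → v i ≠ v j)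
    (hb : ∀ i ∈ Finset.Icc 1 n, ∀ j ∈ Finset.Icc 1 n, i ≠ j → b i ≠ b j)
    (hin : i ∈ Finset.Icc 1 n) (hx : ∀ j, 1 ≤ j → j ≤ n → 0 < x j)
    (hd : ∀ j, 1 ≤ j → j < n → x (j + 1) < x j)
    (H : ∀ z, z < b i → survSet n v z ⊆ survSet n b z) :
    vcgReserveUtil n x v b c i ≤ vcgReserveUtil n x v v c i := by
  by_cases hi : c < b i
  · rw [util_eq hin hi hx, truth_eq hv hin hx]
    have hr1 : 1 ≤ rankOf n b c i := by unfold rankOf; omega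
    refine le_trans (Finset.sum_le_sum (g := fun t =>
      layerW n x t * max (v i - padBid n v c (t + 1)) 0) (fun t ht => ?_))
      (Finset.sum_le_sum_of_subset_of_nonneg (Finset.Ico_subset_Ico_left hr1) ?_)
    · rw [Finset.mem_Ico] at ht
      apply mul_le_mul_of_nonneg_left _ (layerW_pos hx hd t (by omega) (by omega)).le
      apply le_max_of_le_left
      have hlt := padBid_lt hb hi t ht.1
      have hge := padBid_ge c hb (t + 1) (by omega)
      have : padBid n v c (t + 1) ≤ padBid n b c (t + 1) := by
        by_contra h
        push Not at h
        have h1 := (lt_padBid_iff c hv (t + 1) (by omega) _ hge).1 h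
        have h2 := (lt_padBid_iff c hb (t + 1) (by omega) _ hge).2
          (h1.trans (Finset.card_le_card (H _ hlt)))
        exact lt_irrefl _ h2
      linarith
    · intro t ht _
      rw [Finset.mem_Ico] at ht
      exact mul_nonneg (layerW_pos hx hd t ht.1 (by omega)).le (le_max_right _ _)
  · rw [util_zero hi]
    exact truth_nonneg hv hin hx hd

lemma measurable_surv (n : ℕ) (b : ℕ → ℝ) :
    @Measurable ℝ (Finset ℕ) _ ⊤ (fun c => survSet n b c) := by
  letI : MeasurableSpace (Finset ℕ) := ⊤
  apply measurable_to_countable'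
  intro T
  by_cases hT : T ⊆ Finset.Icc 1 n
  · have : (fun c => survSet n b c) ⁻¹' {T} =
        ⋂ j ∈ Finset.Icc 1 n, {c | c < b j ↔ j ∈ T} := by
      ext c
      simp only [Set.mem_preimage, Set.mem_singleton_iff, Set.mem_iInter, Set.mem_ofPred_eq]
      constructor
      · rintro rfl j hj
        simp only [survSet, Finset.mem_filter]
        tauto
      · intro h
        ext j
        simp only [survSet, Finset.mem_filter]
        constructor
        · rintro ⟨h1, h2⟩; exact (h j h1).1 h2
        · intro h1; exact ⟨hT h1, (h j (hT h1)).2 h1⟩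
    rw [this]
    refine Finset.measurableSet_biInter _ (fun j _ => ?_)
    by_cases hj : j ∈ T
    · simp only [hj, iff_true]; exact measurableSet_Iio
    · simp only [hj, iff_false, not_lt]; exact measurableSet_Ici
  · have : (fun c => survSet n b c) ⁻¹' {T} = ∅ := by
      ext c
      simp only [Set.mem_preimage, Set.mem_singleton_iff, Set.mem_empty_iff_false, iff_false]
      rintro rfl
      exact hT (Finset.filter_subset _ _)
    rw [this]
    exact MeasurableSet.empty

lemma util_integrable (n : ℕ) (x v b : ℕ → ℝ) (i : ℕ) (μ : MeasureTheory.Measure ℝ)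
    [MeasureTheory.IsProbabilityMeasure μ] (hμneg : μ (Set.Iio 0) = 0) :
    MeasureTheory.Integrable (fun c => vcgReserveUtil n x v b c i) μ := by
  letI : MeasurableSpace (Finset ℕ) := ⊤
  haveI : DiscreteMeasurableSpace (Finset ℕ) := ⟨fun _ => trivial⟩
  let r : Finset ℕ → ℕ := fun T => (T.filter (fun j => b i < b j)).card + 1
  let A : Finset ℕ → ℝ := fun T => ∑ t ∈ Finset.Icc (r T + 1) T.card,
    (x (t - 1) - x t) * kthHighestBid T b t
  let G : Finset ℕ × ℝ → ℝ := fun p => if i ∈ p.1 then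
    (v i - (1 / x (r p.1)) * (A p.1 + x p.1.card * p.2)) * x (r p.1) else 0
  have hG : Measurable G := by
    apply measurable_from_prod_countable_right
    intro T
    by_cases h : i ∈ T
    · simp only [G, h, if_true]; fun_prop
    · simp only [G, h, if_false]; fun_prop
  have heq : (fun c => vcgReserveUtil n x v b c i) = fun c => G (survSet n b c, c) := rfl
  have hm : Measurable (fun c => vcgReserveUtil n x v b c i) := by
    rw [heq]
    exact hG.comp ((measurable_surv n b).prodMk measurable_id)
  let F : Finset ℕ → ℝ := fun T =>
    (|v i| + |1 / x (r T)| * (|A T| + |x T.card| * |b i|)) * |x (r T)|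
  have hF : ∀ T, 0 ≤ F T := fun T => by simp only [F]; positivity
  refine MeasureTheory.Integrable.of_bound hm.aestronglyMeasurable
    (∑ T ∈ (Finset.Icc 1 n).powerset, F T) ?_
  have hae : ∀ᵐ c ∂μ, 0 ≤ c := by
    rw [MeasureTheory.ae_iff]
    convert hμneg using 2
    ext c; simp
  filter_upwards [hae] with c hc
  have hmem : survSet n b c ∈ (Finset.Icc 1 n).powerset :=
    Finset.mem_powerset.2 (Finset.filter_subset _ _)
  have hle : F (survSet n b c) ≤ ∑ T ∈ (Finset.Icc 1 n).powerset, F T :=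
    Finset.single_le_sum (fun T _ => hF T) hmem
  refine le_trans ?_ hle
  change ‖G (survSet n b c, c)‖ ≤ _
  simp only [G]
  split_ifs with h
  · have hcb : c < b i := (Finset.mem_filter.1 h).2
    have hcabs : |c| ≤ |b i| := by
      rw [abs_of_nonneg hc]; exact hcb.le.trans (le_abs_self _)
    generalize survSet n b c = T
    simp only [F, Real.norm_eq_abs, abs_mul]
    gcongr
    refine (abs_sub _ _).trans ?_
    rw [abs_mul]
    gcongr
    refine (abs_add_le _ _).trans ?_
    rw [abs_mul]
    gcongr
  · simpa using hF _

/-- Truth-telling is a super-strong equilibrium of the VCG auction with a random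
reserve price when there are at least as many slots as bidders: no nonempty coalition
`R` has a deviation (with pairwise distinct reports, agreeing with the true values
outside `R`) in which every member weakly gains in expectation and some member strictly
gains in expectation, the expectation being over the random reserve price `c ∼ μ`. -/
theorem vcgStar_truthful_superStrongEquilibrium
    (n s : ℕ) (x v : ℕ → ℝ) (μ : MeasureTheory.Measure ℝ)
    [MeasureTheory.IsProbabilityMeasure μ]
    (hn : 1 ≤ n) (hns : n ≤ s)
    (hxdec : ∀ j, 1 ≤ j → j < s → x (j + 1) < x j)
    (hxpos : 0 < x s)
    (hvdec : ∀ i, 1 ≤ i → i < n → v (i + 1) < v i)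
    (hvpos : 0 < v n)
    (hμneg : μ (Set.Iio 0) = 0)
    (hμpos : ∀ a b : ℝ, 0 ≤ a → a < b → b ≤ v 1 → 0 < μ (Set.Ioo a b)) :
    ¬ ∃ (R : Finset ℕ) (b' : ℕ → ℝ),
        R ⊆ Finset.Icc 1 n ∧ R.Nonempty ∧
        (∀ i ∈ Finset.Icc 1 n, ∀ i' ∈ Finset.Icc 1 n, i ≠ i' → b' i ≠ b' i') ∧
        (∀ i ∈ Finset.Icc 1 n, i ∉ R → b' i = v i) ∧
        (∀ i ∈ R, ∫ c, vcgReserveUtil n x v v c i ∂μ ≤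
          ∫ c, vcgReserveUtil n x v b' c i ∂μ) ∧
        (∃ i ∈ R, ∫ c, vcgReserveUtil n x v v c i ∂μ <
          ∫ c, vcgReserveUtil n x v b' c i ∂μ) := by
  rintro ⟨R, b, hR, -, hb, hbR, hweak, i₀, hi₀, hstrict⟩
  have hx' : ∀ k, ∀ j, 1 ≤ j → j + k = s → 0 < x j := by
    intro k
    induction k with
    | zero => intro j _ h; simp only [add_zero] at h; rw [h]; exact hxpos
    | succ k ih =>
      intro j h1 h2
      exact (ih (j + 1) (by omega) (by omega)).trans (hxdec j h1 (by omega))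
  have hx : ∀ j, 1 ≤ j → j ≤ n → 0 < x j := fun j h1 h2 => hx' (s - j) j h1 (by omega)
  have hd : ∀ j, 1 ≤ j → j < n → x (j + 1) < x j := fun j h1 h2 => hxdec j h1 (by omega)
  have hvlt' : ∀ k i, 1 ≤ i → i + k + 1 ≤ n → v (i + k + 1) < v i := by
    intro k
    induction k with
    | zero => intro i h1 h2; exact hvdec i h1 (by omega)
    | succ k ih =>
      intro i h1 h2
      exact (hvdec (i + k + 1) (by omega) (by omega)).trans (ih i h1 (by omega))
  have hvlt : ∀ i j, 1 ≤ i → i < j → j ≤ n → v j < v i := by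
    intro i j h1 h2 h3
    have := hvlt' (j - i - 1) i h1 (by omega)
    rwa [show i + (j - i - 1) + 1 = j by omega] at this
  have hv : ∀ i ∈ Finset.Icc 1 n, ∀ j ∈ Finset.Icc 1 n, i ≠ j → v i ≠ v j := by
    intro i hi j hj hij
    rw [Finset.mem_Icc] at hi hj
    rcases lt_or_gt_of_ne hij with h | h
    · exact (hvlt i j hi.1 h hj.2).ne'
    · exact (hvlt j i hj.1 h hi.2).ne
  have hInt : ∀ (b : ℕ → ℝ) (i : ℕ),
      MeasureTheory.Integrable (fun c => vcgReserveUtil n x v b c i) μ :=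
    fun b i => util_integrable n x v b i μ hμneg
  by_cases hU : ((Finset.Icc 1 n).filter (fun j => b j < v j)).Nonempty
  · obtain ⟨i, hi, hmin⟩ := Finset.exists_min_image _ b hU
    rw [Finset.mem_filter] at hi
    obtain ⟨hin, hiv⟩ := hi
    have hiR : i ∈ R := by
      by_contra h
      exact hiv.ne (hbR i hin h)
    have hle : ∀ c, vcgReserveUtil n x v b c i ≤ vcgReserveUtil n x v v c i := by
      intro c
      apply dev_le hv hb hin hx hd
      intro z hz j hj
      simp only [survSet, Finset.mem_filter] at hj ⊢
      refine ⟨hj.1, ?_⟩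
      by_cases hjv : b j < v j
      · exact hz.trans_le (hmin j (Finset.mem_filter.2 ⟨hj.1, hjv⟩))
      · exact hj.2.trans_le (not_lt.1 hjv)
    have heq : ∫ c, vcgReserveUtil n x v b c i ∂μ = ∫ c, vcgReserveUtil n x v v c i ∂μ :=
      le_antisymm (MeasureTheory.integral_mono (hInt b i) (hInt v i) hle) (hweak i hiR)
    have hae := (MeasureTheory.integral_eq_iff_of_ae_le (hInt b i) (hInt v i)
      (Filter.Eventually.of_forall hle)).1 heq
    have hin' := Finset.mem_Icc.1 hin
    have hvi : 0 < v i := by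
      rcases eq_or_lt_of_le hin'.2 with h | h
      · rw [h]; exact hvpos
      · exact hvpos.trans (hvlt i n hin'.1 h le_rfl)
    have hv1 : v i ≤ v 1 := by
      rcases eq_or_lt_of_le hin'.1 with h | h
      · rw [← h]
      · exact (hvlt 1 i le_rfl h hin'.2).le
    have hpos := hμpos (max (b i) 0) (v i) (le_max_right _ _) (max_lt hiv hvi) hv1
    have hzero : μ (Set.Ioo (max (b i) 0) (v i)) = 0 := by
      refine MeasureTheory.measure_mono_null ?_ (MeasureTheory.ae_iff.1 hae)
      intro c hc
      simp only [Set.mem_ofPred_eq]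
      have h1 : ¬ c < b i := not_lt.2 ((le_max_left _ _).trans hc.1.le)
      rw [util_zero h1]
      exact (truth_pos hn hv hin hx hd hc.2).ne
    exact hpos.ne' hzero
  · have hall : ∀ j ∈ Finset.Icc 1 n, v j ≤ b j := by
      intro j hj
      by_contra h
      exact hU ⟨j, Finset.mem_filter.2 ⟨hj, not_le.1 h⟩⟩
    refine absurd hstrict (not_lt.2 (MeasureTheory.integral_mono (hInt b i₀) (hInt v i₀) ?_))
    intro c
    apply dev_le hv hb (hR hi₀) hx hd
    intro z hz j hj
    simp only [survSet, Finset.mem_filter] at hj ⊢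
    exact ⟨hj.1, hj.2.trans_le (hall j hj.1)⟩
end

section
/- Let q = n mod m with q > 0, assume c(⌈n/m⌉) > c(⌈n/m⌉ − 1), and let a profile of the two-step resource selection game be nearly balanced in both steps. Then a pair of distinct agents {i, i'} has a strict deviation if and only if i and i' choose the same resource in step 1 and that resource is full in step 1, and they choose the same resource in step 2 and that resource is full in step 2. -/
/-- Number of agents (among `{1,…,n}`) choosing resource `r` under the choice function
`a` (one step of a two-step resource selection game). -/
def rsgLoad (n : ℕ) (a : ℕ → ℕ) (r : ℕ) : ℕ :=
  ((Finset.Icc 1 n).filter (fun i => a i = r)).card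

/-- Cost to agent `i` in the two-step resource selection game with cost function `c`,
first-step choices `a` and second-step choices `b`:
`c(L_1(a_i)) + c(L_2(b_i))`. -/
def rsgCost (n : ℕ) (c : ℕ → ℝ) (a b : ℕ → ℕ) (i : ℕ) : ℝ :=
  c (rsgLoad n a (a i)) + c (rsgLoad n b (b i))

/-- The pair of distinct agents `{i, i'}` has a strict deviation from the profile
`(a, b)`: there are alternative strategy pairs for `i` and `i'` (all other agents
unchanged) under which both `i` and `i'` incur strictly smaller cost. -/
def rsgPairDev (n m : ℕ) (c : ℕ → ℝ) (a b : ℕ → ℕ) (i i' : ℕ) : Prop :=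
  ∃ p q p' q' : ℕ, p ∈ Finset.Icc 1 m ∧ q ∈ Finset.Icc 1 m ∧
    p' ∈ Finset.Icc 1 m ∧ q' ∈ Finset.Icc 1 m ∧
    rsgCost n c (Function.update (Function.update a i p) i' p')
        (Function.update (Function.update b i q) i' q') i < rsgCost n c a b i ∧
    rsgCost n c (Function.update (Function.update a i p) i' p')
        (Function.update (Function.update b i q) i' q') i' < rsgCost n c a b i' 

theorem rsgLoad_update (n : ℕ) (a : ℕ → ℕ) (i p r : ℕ) (hi : i ∈ Finset.Icc 1 n) :
    rsgLoad n (Function.update a i p) r + (if a i = r then 1 else 0)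
      = rsgLoad n a r + (if p = r then 1 else 0) := by
  unfold rsgLoad
  simp only [Finset.card_filter]
  rw [← Finset.add_sum_erase _ _ hi, ← Finset.add_sum_erase _ (fun j => if a j = r then 1 else 0) hi]
  have : ∑ x ∈ (Finset.Icc 1 n).erase i, (if Function.update a i p x = r then 1 else 0)
      = ∑ x ∈ (Finset.Icc 1 n).erase i, (if a x = r then 1 else 0) := by
    apply Finset.sum_congr rfl
    intro x hx
    rw [Function.update_of_ne (Finset.ne_of_mem_erase hx)]
  rw [this]
  simp only [Function.update_self]
  omega

theorem rsgLoad_update₂ (n : ℕ) (a : ℕ → ℕ) (i i' p p' r : ℕ) (hi : i ∈ Finset.Icc 1 n)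
    (hi' : i' ∈ Finset.Icc 1 n) (hne : i ≠ i') :
    rsgLoad n (Function.update (Function.update a i p) i' p') r
      + (if a i = r then 1 else 0) + (if a i' = r then 1 else 0)
      = rsgLoad n a r + (if p = r then 1 else 0) + (if p' = r then 1 else 0) := by
  have h1 := rsgLoad_update n a i p r hi
  have h2 := rsgLoad_update n (Function.update a i p) i' p' r hi'
  rw [Function.update_of_ne hne.symm] at h2
  omega

theorem rsgLoad_pos (n : ℕ) (a : ℕ → ℕ) (i : ℕ) (hi : i ∈ Finset.Icc 1 n) :
    1 ≤ rsgLoad n a (a i) :=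
  Finset.card_pos.2 ⟨i, Finset.mem_filter.2 ⟨hi, rfl⟩⟩

theorem rsgLoad_le (n : ℕ) (a : ℕ → ℕ) (r : ℕ) : rsgLoad n a r ≤ n := by
  unfold rsgLoad
  exact (Finset.card_filter_le _ _).trans (by simp)

/-- the key one-step estimates -/
theorem rsg_step (n m k : ℕ) (c : ℕ → ℝ) (a : ℕ → ℕ) (hkn : k < n)
    (hmono : ∀ i, 1 ≤ i → i < n → c i ≤ c (i + 1))
    (hconv : ∀ i j, 1 ≤ i → i < j → j < n → c (i + 1) - c i ≤ c (j + 1) - c j)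
    (hstrict : c k < c (k + 1))
    (ha : ∀ i ∈ Finset.Icc 1 n, a i ∈ Finset.Icc 1 m)
    (hbal : ∀ r ∈ Finset.Icc 1 m, rsgLoad n a r = k ∨ rsgLoad n a r = k + 1)
    (i i' : ℕ) (hi : i ∈ Finset.Icc 1 n) (hi' : i' ∈ Finset.Icc 1 n) (hne : i ≠ i')
    (p p' : ℕ) (hp : p ∈ Finset.Icc 1 m) (hp' : p' ∈ Finset.Icc 1 m) (x x' : ℝ)
    (hx : x = c (rsgLoad n (Function.update (Function.update a i p) i' p') p)
      - c (rsgLoad n a (a i)))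
    (hx' : x' = c (rsgLoad n (Function.update (Function.update a i p) i' p') p')
      - c (rsgLoad n a (a i'))) :
    -(c (k + 1) - c k) ≤ x ∧ (x < 0 → 0 ≤ x') ∧
      (x < 0 → ¬ (a i = a i' ∧ rsgLoad n a (a i) = k + 1) → c (k + 1) - c k ≤ x') := by
  have mono : ∀ u v, 1 ≤ u → u ≤ v → v ≤ n → c u ≤ c v := by
    intro u v hu huv
    induction v, huv using Nat.le_induction with
    | base => intro _; exact le_rfl
    | succ v hv ih => intro hvn; exact (ih (by omega)).trans (hmono v (by omega) (by omega))
  have e1 := rsgLoad_update₂ n a i i' p p' p hi hi' hne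
  have e2 := rsgLoad_update₂ n a i i' p p' p' hi hi' hne
  have N1 := rsgLoad_pos n (Function.update (Function.update a i p) i' p') i hi
  have N2 := rsgLoad_pos n (Function.update (Function.update a i p) i' p') i' hi'
  rw [Function.update_of_ne hne, Function.update_self] at N1
  rw [Function.update_self] at N2
  have M1 := rsgLoad_le n (Function.update (Function.update a i p) i' p') p
  have M2 := rsgLoad_le n (Function.update (Function.update a i p) i' p') p'
  have l1 := rsgLoad_pos n a i hi
  have l2 := rsgLoad_pos n a i' hi'
  have b1 := hbal _ (ha i hi)
  have b2 := hbal _ (ha i' hi')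
  have b3 := hbal _ hp
  have b4 := hbal _ hp'
  generalize hP : rsgLoad n (Function.update (Function.update a i p) i' p') p = P at *
  generalize hP' : rsgLoad n (Function.update (Function.update a i p) i' p') p' = P' at *
  clear hP hP'
  have key : rsgLoad n a (a i) ≤ P + 1 ∧ (P < rsgLoad n a (a i) → rsgLoad n a (a i') ≤ P' ∧
      (¬ (a i = a i' ∧ rsgLoad n a (a i) = k + 1) →
        k + 1 ≤ P' ∧ rsgLoad n a (a i') = k)) := by
    clear hx hx' hmono hconv hstrict mono
    generalize a i = s at *
    generalize a i' = s' at *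
    clear ha hbal
    by_cases h1 : s = p <;> by_cases h2 : s' = p <;> by_cases h3 : s = p' <;>
      by_cases h4 : s' = p' <;> by_cases h5 : p = p' <;> by_cases h6 : s = s' <;>
      grind
  obtain ⟨kA, kB⟩ := key
  have neg : x < 0 → P < rsgLoad n a (a i) := by
    intro h
    by_contra hc
    have := mono _ _ l1 (not_lt.1 hc) M1
    linarith
  refine ⟨?_, ?_, ?_⟩
  · by_cases h : P < rsgLoad n a (a i)
    · have hP : rsgLoad n a (a i) = P + 1 := by omega
      rw [hP] at hx b1
      rcases b1 with b1 | b1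
      · have := hconv P k N1 (by omega) hkn
        linarith
      · have : P = k := by omega
        subst this
        linarith
    · have := mono _ _ l1 (not_lt.1 h) M1
      linarith
  · intro h
    have := mono _ _ l2 (kB (neg h)).1 M2
    linarith
  · intro h hs
    obtain ⟨h1, h2⟩ := (kB (neg h)).2 hs
    rw [h2] at hx'
    have := mono _ _ (by omega) h1 M2
    linarith

theorem rsg_exists_nonfull (n m : ℕ) (a : ℕ → ℕ) (hq : 0 < n % m)
    (ha : ∀ i ∈ Finset.Icc 1 n, a i ∈ Finset.Icc 1 m)
    (hbal : ∀ r ∈ Finset.Icc 1 m, rsgLoad n a r = n / m ∨ rsgLoad n a r = n / m + 1) :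
    ∃ s ∈ Finset.Icc 1 m, rsgLoad n a s = n / m := by
  by_contra! hc
  have h := Finset.card_eq_sum_card_fiberwise (f := a) (s := Finset.Icc 1 n)
    (t := Finset.Icc 1 m) (fun i hi => ha i hi)
  have h2 : ∑ r ∈ Finset.Icc 1 m, rsgLoad n a r = ∑ r ∈ Finset.Icc 1 m, (n / m + 1) :=
    Finset.sum_congr rfl (fun r hr => (hbal r hr).resolve_left (hc r hr))
  have h3 : n = m * (n / m + 1) := by
    have : (Finset.Icc 1 n).card = ∑ r ∈ Finset.Icc 1 m, rsgLoad n a r := h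
    rw [h2] at this
    simpa using this
  have : n % m = 0 := Nat.mod_eq_zero_of_dvd ⟨_, h3⟩
  omega

/-- In a two-step resource selection game with a nondecreasing convex cost function,
`q = n mod m > 0` and `c(⌈n/m⌉) > c(⌈n/m⌉ − 1)`, given a profile that is nearly
balanced in both steps, a pair of distinct agents `{i, i'}` has a strict deviation
iff `i` and `i'` share a full resource in step 1 and share a full resource in step 2.
(Here `⌊n/m⌋ = n/m` and `⌈n/m⌉ = n/m + 1` since `n mod m > 0`.) -/
theorem rsg_two_step_pair_deviation_characterization
    (n m : ℕ) (c : ℕ → ℝ) (a b : ℕ → ℕ)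
    (hm : 2 ≤ m) (hn : 1 ≤ n)
    (hmono : ∀ i, 1 ≤ i → i < n → c i ≤ c (i + 1))
    (hconv : ∀ i j, 1 ≤ i → i < j → j < n → c (i + 1) - c i ≤ c (j + 1) - c j)
    (hq : 0 < n % m)
    (hstrict : c (n / m) < c (n / m + 1))
    (ha : ∀ i ∈ Finset.Icc 1 n, a i ∈ Finset.Icc 1 m)
    (hb : ∀ i ∈ Finset.Icc 1 n, b i ∈ Finset.Icc 1 m)
    (hbal1 : ∀ r ∈ Finset.Icc 1 m, rsgLoad n a r = n / m ∨ rsgLoad n a r = n / m + 1)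
    (hbal2 : ∀ r ∈ Finset.Icc 1 m, rsgLoad n b r = n / m ∨ rsgLoad n b r = n / m + 1) :
    ∀ i ∈ Finset.Icc 1 n, ∀ i' ∈ Finset.Icc 1 n, i ≠ i' →
      (rsgPairDev n m c a b i i' ↔
        (a i = a i' ∧ rsgLoad n a (a i) = n / m + 1 ∧
          b i = b i' ∧ rsgLoad n b (b i) = n / m + 1)) := by
  intro i hi i' hi' hne
  have hkn : n / m < n := Nat.div_lt_self hn hm
  constructor
  · rintro ⟨p, q, p', q', hp, hq1, hp', hq1', hd, hd'⟩
    unfold rsgCost at hd hd'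
    simp only [Function.update_self, Function.update_of_ne hne] at hd hd'
    obtain ⟨A1, A2, A3⟩ := rsg_step n m _ c a hkn hmono hconv hstrict ha hbal1 i i' hi hi' hne
      p p' hp hp' _ _ rfl rfl
    obtain ⟨B1, B2, B3⟩ := rsg_step n m _ c b hkn hmono hconv hstrict hb hbal2 i i' hi hi' hne
      q q' hq1 hq1' _ _ rfl rfl
    obtain ⟨A1', A2', A3'⟩ := rsg_step n m _ c a hkn hmono hconv hstrict ha hbal1 i' i hi' hi
      hne.symm p' p hp' hp _ _ rfl rfl
    obtain ⟨B1', B2', B3'⟩ := rsg_step n m _ c b hkn hmono hconv hstrict hb hbal2 i' i hi' hi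
      hne.symm q' q hq1' hq1 _ _ rfl rfl
    rw [Function.update_comm hne.symm] at A1' A2' A3' B1' B2' B3'
    have sA : (a i' = a i ∧ rsgLoad n a (a i') = n / m + 1) ↔
        (a i = a i' ∧ rsgLoad n a (a i) = n / m + 1) := by
      constructor <;> (rintro ⟨h, h2⟩; exact ⟨h.symm, h ▸ h2⟩)
    have sB : (b i' = b i ∧ rsgLoad n b (b i') = n / m + 1) ↔
        (b i = b i' ∧ rsgLoad n b (b i) = n / m + 1) := by
      constructor <;> (rintro ⟨h, h2⟩; exact ⟨h.symm, h ▸ h2⟩)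
    rw [sA] at A3'
    rw [sB] at B3'
    rw [← and_assoc, ← and_assoc, and_assoc (b := b i = b i')]
    generalize c (rsgLoad n (Function.update (Function.update a i p) i' p') p) = u1 at *
    generalize c (rsgLoad n (Function.update (Function.update a i p) i' p') p') = u2 at *
    generalize c (rsgLoad n (Function.update (Function.update b i q) i' q') q) = v1 at *
    generalize c (rsgLoad n (Function.update (Function.update b i q) i' q') q') = v2 at *
    have stepA : (a i = a i' ∧ rsgLoad n a (a i) = n / m + 1) := by
      by_contra hs
      have h1 : ¬ (u1 - c (rsgLoad n a (a i)) < 0) := fun h => by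
        have := A3 h hs
        linarith
      have h2 : ¬ (u2 - c (rsgLoad n a (a i')) < 0) := fun h => by
        have := A3' h hs
        linarith
      have := B2 (by linarith)
      linarith
    have stepB : (b i = b i' ∧ rsgLoad n b (b i) = n / m + 1) := by
      by_contra hs
      have h1 : ¬ (v1 - c (rsgLoad n b (b i)) < 0) := fun h => by
        have := B3 h hs
        linarith
      have h2 : ¬ (v2 - c (rsgLoad n b (b i')) < 0) := fun h => by
        have := B3' h hs
        linarith
      have := A2 (by linarith)
      linarith
    exact ⟨stepA, stepB⟩
  · rintro ⟨ea, fa, eb, fb⟩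
    obtain ⟨s, hs, ls⟩ := rsg_exists_nonfull n m a hq ha hbal1
    obtain ⟨t, ht, lt⟩ := rsg_exists_nonfull n m b hq hb hbal2
    have hsa : a i' ≠ s := by
      rintro rfl
      rw [ea] at fa
      omega
    have htb : b i' ≠ t := by
      rintro rfl
      rw [eb] at fb
      omega
    refine ⟨s, b i, a i', t, hs, hb i hi, ha i' hi', ht, ?_, ?_⟩
    all_goals
      unfold rsgCost
      simp only [Function.update_self, Function.update_of_ne hne]
      have e1 := rsgLoad_update₂ n a i i' s (a i') s hi hi' hne
      have e2 := rsgLoad_update₂ n a i i' s (a i') (a i') hi hi' hne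
      have e3 := rsgLoad_update₂ n b i i' (b i) t (b i) hi hi' hne
      have e4 := rsgLoad_update₂ n b i i' (b i) t t hi hi' hne
      rw [ea] at fa
      rw [eb] at fb
      simp only [ea, eb, hsa, htb, hsa.symm, htb.symm, if_true, if_false, ls, lt, fa, fb]
        at e1 e2 e3 e4 ⊢
    · rw [show rsgLoad n _ s = n / m + 1 by omega, show rsgLoad n _ (b i') = n / m by omega]
      linarith
    · rw [show rsgLoad n _ (a i') = n / m by omega, show rsgLoad n _ t = n / m + 1 by omega]
      linarith
end

section
/- If q = n mod m satisfies 0 < q ≤ m/2, then the two-step resource selection game has a profile that is nearly balanced in both steps, in which no two distinct agents share a resource that is full in step 1 and also share a resource that is full in step 2; consequently no single agent has a strictly cost-decreasing unilateral deviation and no pair of distinct agents has a strict deviation. -/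
/-- Agent `i` has a strictly cost-decreasing unilateral deviation from the profile
`(a, b)`. -/
def rsgUniDev (n m : ℕ) (c : ℕ → ℝ) (a b : ℕ → ℕ) (i : ℕ) : Prop :=
  ∃ p q : ℕ, p ∈ Finset.Icc 1 m ∧ q ∈ Finset.Icc 1 m ∧
    rsgCost n c (Function.update a i p) (Function.update b i q) i < rsgCost n c a b i

theorem rsg_aload (n m s : ℕ) (hm : 0 < m) (hs : s < m) :
    rsgLoad n (fun j => (j - 1) % m + 1) (s + 1) = n / m + if s < n % m then 1 else 0 := by
  have h := Nat.count_modEq_card n hm s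
  rw [Nat.mod_eq_of_lt hs] at h
  rw [← h, Nat.count_eq_card_filter_range, rsgLoad]
  apply Finset.card_nbij' (fun j => j - 1) (fun j => j + 1)
  · intro j hj
    simp only [Finset.coe_filter, Finset.mem_Icc, Set.mem_ofPred_eq, Finset.mem_range] at hj ⊢
    refine ⟨by omega, ?_⟩
    unfold Nat.ModEq
    rw [Nat.mod_eq_of_lt hs]; omega
  · intro j hj
    simp only [Finset.coe_filter, Finset.mem_Icc, Set.mem_ofPred_eq, Finset.mem_range] at hj ⊢
    have h2 := hj.2
    unfold Nat.ModEq at h2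
    rw [Nat.mod_eq_of_lt hs] at h2
    refine ⟨by omega, ?_⟩
    simpa using h2
  · intro j hj
    simp only [Finset.coe_filter, Finset.mem_Icc, Set.mem_ofPred_eq] at hj
    show j - 1 + 1 = j
    omega
  · intro j hj
    rfl

/-- Row-wise reflection of the agents in the complete rows. -/
def rsgRefl (n m i : ℕ) : ℕ :=
  if i ≤ m * (n / m) then 2 * (m * ((i - 1) / m)) + m + 1 - i else i

theorem rsgRefl_spec (n m i : ℕ) (hm : 0 < m) (hi : 1 ≤ i) (h : i ≤ m * (n / m)) :
    (rsgRefl n m i - 1) / m = (i - 1) / m ∧ (rsgRefl n m i - 1) % m = m - 1 - (i - 1) % m ∧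
      1 ≤ rsgRefl n m i ∧ rsgRefl n m i ≤ m * (n / m) ∧
      rsgRefl n m (rsgRefl n m i) = i := by
  have h1 := Nat.div_add_mod (i - 1) m
  have h2 := Nat.mod_lt (i - 1) hm
  have e : rsgRefl n m i = 2 * (m * ((i - 1) / m)) + m + 1 - i := if_pos h
  have e1 : rsgRefl n m i - 1 = (m - 1 - (i - 1) % m) + m * ((i - 1) / m) := by omega
  have hd : (rsgRefl n m i - 1) / m = (i - 1) / m := by
    rw [e1, Nat.add_mul_div_left _ _ hm, Nat.div_eq_of_lt (by omega)]; omega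
  have hmod : (rsgRefl n m i - 1) % m = m - 1 - (i - 1) % m := by
    rw [e1, Nat.add_mul_mod_self_left, Nat.mod_eq_of_lt (by omega)]
  have hlt : (i - 1) / m < n / m := by
    rw [Nat.div_lt_iff_lt_mul hm, mul_comm]; omega
  have hle : m * ((i - 1) / m + 1) ≤ m * (n / m) := Nat.mul_le_mul_left _ hlt
  rw [mul_add, mul_one] at hle
  have hb : rsgRefl n m i ≤ m * (n / m) := by omega
  refine ⟨hd, hmod, by omega, hb, ?_⟩
  have e2 : rsgRefl n m (rsgRefl n m i) =
      2 * (m * ((rsgRefl n m i - 1) / m)) + m + 1 - rsgRefl n m i := if_pos hb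
  rw [e2, hd]; omega

theorem rsgRefl_mem (n m i : ℕ) (hm : 0 < m) (hi : 1 ≤ i) (hn : i ≤ n) :
    (1 ≤ rsgRefl n m i ∧ rsgRefl n m i ≤ n) ∧ rsgRefl n m (rsgRefl n m i) = i := by
  by_cases h : i ≤ m * (n / m)
  · obtain ⟨-, -, h3, h4, h5⟩ := rsgRefl_spec n m i hm hi h
    have := Nat.mul_div_le n m
    exact ⟨⟨h3, by omega⟩, h5⟩
  · have e : rsgRefl n m i = i := if_neg h
    rw [e, e]; exact ⟨⟨hi, hn⟩, rfl⟩

theorem rsg_bload (n m : ℕ) (hm : 0 < m) (a : ℕ → ℕ) (r : ℕ) :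
    rsgLoad n (fun i => a (rsgRefl n m i)) r = rsgLoad n a r := by
  unfold rsgLoad
  apply Finset.card_nbij' (rsgRefl n m) (rsgRefl n m)
  · intro j hj
    simp only [Finset.coe_filter, Finset.mem_Icc, Set.mem_ofPred_eq] at hj ⊢
    exact ⟨(rsgRefl_mem n m j hm hj.1.1 hj.1.2).1, hj.2⟩
  · intro j hj
    simp only [Finset.coe_filter, Finset.mem_Icc, Set.mem_ofPred_eq] at hj ⊢
    have := rsgRefl_mem n m j hm hj.1.1 hj.1.2
    exact ⟨this.1, by rw [this.2]; exact hj.2⟩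
  · intro j hj
    simp only [Finset.coe_filter, Finset.mem_Icc, Set.mem_ofPred_eq] at hj
    exact (rsgRefl_mem n m j hm hj.1.1 hj.1.2).2
  · intro j hj
    simp only [Finset.coe_filter, Finset.mem_Icc, Set.mem_ofPred_eq] at hj
    exact (rsgRefl_mem n m j hm hj.1.1 hj.1.2).2

/-- Splitting one agent off the load. -/
theorem rsgLoad_split1 (n : ℕ) (a : ℕ → ℕ) (r i : ℕ) (hi : i ∈ Finset.Icc 1 n) :
    rsgLoad n a r = (((Finset.Icc 1 n).erase i).filter (fun j => a j = r)).card
      + if a i = r then 1 else 0 := by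
  unfold rsgLoad
  rw [Finset.filter_erase]
  split_ifs with h
  · rw [Finset.card_erase_add_one]; simp only [Finset.mem_filter]; exact ⟨hi, h⟩
  · rw [Finset.erase_eq_of_notMem]; · rfl
    simp [h]

theorem rsgLoad_split2 (n : ℕ) (a : ℕ → ℕ) (r i i' : ℕ) (hi : i ∈ Finset.Icc 1 n)
    (hi' : i' ∈ Finset.Icc 1 n) (hne : i ≠ i') :
    rsgLoad n a r = ((((Finset.Icc 1 n).erase i).erase i').filter (fun j => a j = r)).card
      + (if a i = r then 1 else 0) + if a i' = r then 1 else 0 := by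
  rw [rsgLoad_split1 n a r i hi]
  have : (((Finset.Icc 1 n).erase i).filter (fun j => a j = r)).card =
    ((((Finset.Icc 1 n).erase i).erase i').filter (fun j => a j = r)).card
      + if a i' = r then 1 else 0 := by
    rw [Finset.filter_erase (fun j => a j = r) i']
    split_ifs with h
    · rw [Finset.card_erase_add_one]; simp only [Finset.mem_filter, Finset.mem_erase]
      exact ⟨⟨hne.symm, hi'⟩, h⟩
    · rw [Finset.erase_eq_of_notMem (a := i')]; · rfl
      simp [h]
  omega

/-- Unilateral move in one step. -/
theorem rsg_uni_step (n m k : ℕ) (a : ℕ → ℕ) (i p : ℕ) (hi : i ∈ Finset.Icc 1 n)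
    (hai : a i ∈ Finset.Icc 1 m)
    (hp : p ∈ Finset.Icc 1 m)
    (hbal : ∀ r ∈ Finset.Icc 1 m, rsgLoad n a r = k ∨ rsgLoad n a r = k + 1) :
    rsgLoad n a (a i) ≤ rsgLoad n (Function.update a i p) (Function.update a i p i) ∧
      1 ≤ rsgLoad n a (a i) := by
  have key : ∀ r, (((Finset.Icc 1 n).erase i).filter (fun j => Function.update a i p j = r)) =
      (((Finset.Icc 1 n).erase i).filter (fun j => a j = r)) := by
    intro r
    apply Finset.filter_congr
    intro j hj
    rw [Function.update_of_ne (Finset.ne_of_mem_erase hj)]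
  have h1 := hbal _ hai
  have h2 := hbal _ hp
  rw [rsgLoad_split1 n _ _ i hi] at h1 h2 ⊢
  rw [rsgLoad_split1 n (Function.update a i p) _ i hi, key]
  simp only [Function.update_self]
  by_cases h : a i = p
  · subst h; simp
  · simp only [h, if_true, if_false] at h1 h2 ⊢
    omega

set_option maxHeartbeats 4000000 in
/-- Joint move in one step: relations between the old and the new loads. -/
theorem rsg_pair_step (n m k : ℕ) (a : ℕ → ℕ) (i i' p p' : ℕ) (hi : i ∈ Finset.Icc 1 n)
    (hi' : i' ∈ Finset.Icc 1 n) (hne : i ≠ i')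
    (hai : a i ∈ Finset.Icc 1 m) (hai' : a i' ∈ Finset.Icc 1 m)
    (hp : p ∈ Finset.Icc 1 m) (hp' : p' ∈ Finset.Icc 1 m)
    (hbal : ∀ r ∈ Finset.Icc 1 m, rsgLoad n a r = k ∨ rsgLoad n a r = k + 1)
    (l l' N N' : ℕ) (f : ℕ → ℕ) (hf : f = Function.update (Function.update a i p) i' p')
    (hl : l = rsgLoad n a (a i)) (hl' : l' = rsgLoad n a (a i'))
    (hN : N = rsgLoad n f (f i)) (hN' : N' = rsgLoad n f (f i')) :
    (1 ≤ l ∧ 1 ≤ l' ∧ 1 ≤ N ∧ 1 ≤ N') ∧ (l ≤ k + 1 ∧ l' ≤ k + 1) ∧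
    (l ≤ N + 1 ∧ l' ≤ N' + 1) ∧ (l ≤ N ∨ l' ≤ N') ∧
    (¬ (a i = a i' ∧ l = k + 1) →
      (N < l → l' ≤ k ∧ k + 1 ≤ N') ∧ (N' < l' → l ≤ k ∧ k + 1 ≤ N)) := by
  have fi : f i = p := by rw [hf, Function.update_of_ne hne, Function.update_self]
  have fi' : f i' = p' := by rw [hf, Function.update_self]
  have key : ∀ r, ((((Finset.Icc 1 n).erase i).erase i').filter (fun j => f j = r)) =
      ((((Finset.Icc 1 n).erase i).erase i').filter (fun j => a j = r)) := by
    intro r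
    apply Finset.filter_congr
    intro j hj
    rw [hf, Function.update_of_ne (Finset.ne_of_mem_erase hj),
      Function.update_of_ne (Finset.ne_of_mem_erase (Finset.mem_of_mem_erase hj))]
  have h1 := hbal _ hai
  have h2 := hbal _ hai'
  have h3 := hbal _ hp
  have h4 := hbal _ hp'
  rw [rsgLoad_split2 n _ _ i i' hi hi' hne] at h1 h2 h3 h4 hl hl' hN hN'
  rw [key, fi, fi'] at hN hN'
  generalize hB : (fun r => ((((Finset.Icc 1 n).erase i).erase i').filter
    (fun j => a j = r)).card) = B at *
  have hB' : ∀ r, ((((Finset.Icc 1 n).erase i).erase i').filter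
    (fun j => a j = r)).card = B r := fun r => by rw [← hB]
  simp only [hB'] at h1 h2 h3 h4 hl hl' hN hN'
  generalize a i = x at *
  generalize a i' = x' at *
  clear hf key hB hB' hbal fi fi'
  have b1 : x = x' → B x = B x' := fun h => by rw [h]
  have b2 : x = p → B x = B p := fun h => by rw [h]
  have b3 : x = p' → B x = B p' := fun h => by rw [h]
  have b4 : x' = p → B x' = B p := fun h => by rw [h]
  have b5 : x' = p' → B x' = B p' := fun h => by rw [h]
  have b6 : p = p' → B p = B p' := fun h => by rw [h]
  clear hai hai' hp hp' hi hi' hne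
  simp only [if_true] at h1 h2 hl hl' hN hN'
  generalize B x = Bx at *
  generalize B x' = Bx' at *
  generalize B p = Bp at *
  generalize B p' = Bp' at *
  have ind : ∀ u v : ℕ, (u = v ∧ (if u = v then 1 else 0) = 1 ∧ (if v = u then 1 else 0) = 1) ∨
      (u ≠ v ∧ (if u = v then 1 else 0) = 0 ∧ (if v = u then 1 else 0) = 0) := by
    intro u v
    by_cases h : u = v
    · simp [h]
    · simp [h, Ne.symm h]
  have i0 := ind x x'
  have i1 := ind x p
  have i2 := ind x p'
  have i3 := ind x' p
  have i4 := ind x' p'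
  have i5 := ind p p'
  clear ind
  generalize (if x = x' then 1 else 0) = t0 at *
  generalize (if x = p then 1 else 0) = t1 at *
  generalize (if x = p' then 1 else 0) = t2 at *
  generalize (if x' = p then 1 else 0) = t3 at *
  generalize (if x' = p' then 1 else 0) = t4 at *
  generalize (if p = p' then 1 else 0) = t5 at *
  generalize (if x' = x then 1 else 0) = t6 at *
  generalize (if p' = p then 1 else 0) = t7 at *
  rcases i0 with ⟨e0, f0, g0⟩ | ⟨e0, f0, g0⟩ <;> rcases i1 with ⟨e1, f1, g1⟩ | ⟨e1, f1, g1⟩ <;>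
  rcases i2 with ⟨e2, f2, g2⟩ | ⟨e2, f2, g2⟩ <;> rcases i3 with ⟨e3, f3, g3⟩ | ⟨e3, f3, g3⟩ <;>
  rcases i4 with ⟨e4, f4, g4⟩ | ⟨e4, f4, g4⟩ <;> rcases i5 with ⟨e5, f5, g5⟩ | ⟨e5, f5, g5⟩ <;>
  first
  | (exfalso; clear h1 h2 h3 h4 b1 b2 b3 b4 b5 b6; omega)
  | (simp only [e0, e1, e2, e3, e4, e5, true_implies, false_implies] at b1 b2 b3 b4 b5 b6
     omega)

/-- Real-valued consequences. -/
theorem rsg_gain (n k : ℕ) (c : ℕ → ℝ) (hk : k + 1 ≤ n)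
    (hm1 : ∀ i, 1 ≤ i → i < n → c i ≤ c (i + 1))
    (hconv : ∀ i j, 1 ≤ i → i < j → j < n → c (i + 1) - c i ≤ c (j + 1) - c j) :
    ∃ d : ℝ, (∀ l N, 1 ≤ N → l ≤ N → N ≤ n → 1 ≤ l → c l ≤ c N) ∧
      (∀ l N, 1 ≤ N → l ≤ N + 1 → N ≤ n → 1 ≤ l → l ≤ k + 1 → c l - c N ≤ d) ∧
      (∀ l N, 1 ≤ l → l ≤ k → k + 1 ≤ N → N ≤ n → d ≤ c N - c l) := by
  have mono : ∀ l N, 1 ≤ l → l ≤ N → N ≤ n → c l ≤ c N := by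
    intro l N h1 h2 h3
    induction N, h2 using Nat.le_induction with
    | base => exact le_rfl
    | succ N h ih => exact (ih (by omega)).trans (hm1 N (by omega) (by omega))
  refine ⟨if k = 0 then 0 else c (k + 1) - c k, fun l N _ h2 h3 h4 => mono l N h4 h2 h3, ?_, ?_⟩
  · intro l N h1 h2 h3 h4 h5
    split_ifs with h0
    · have := mono l N h4 (by omega) h3
      linarith
    · have hd := hm1 k (by omega) (by omega)
      rcases Nat.lt_or_ge N l with h | h
      · have : l = N + 1 := by omega
        subst this
        rcases Nat.lt_or_ge N k with h' | h'
        · exact hconv N k h1 h' (by omega)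
        · have : N = k := by omega
          subst this; exact le_rfl
      · have := mono l N h4 h h3
        linarith
  · intro l N h1 h2 h3 h4
    rw [if_neg (by omega)]
    have := mono l k h1 h2 (by omega)
    have := mono (k + 1) N (by omega) h3 h4
    linarith

theorem rsg_no_dev (n m k : ℕ) (c : ℕ → ℝ) (a b : ℕ → ℕ) (hk : k + 1 ≤ n)
    (hm1 : ∀ i, 1 ≤ i → i < n → c i ≤ c (i + 1))
    (hconv : ∀ i j, 1 ≤ i → i < j → j < n → c (i + 1) - c i ≤ c (j + 1) - c j)
    (hab : ∀ i ∈ Finset.Icc 1 n, a i ∈ Finset.Icc 1 m ∧ b i ∈ Finset.Icc 1 m)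
    (ha : ∀ r ∈ Finset.Icc 1 m, rsgLoad n a r = k ∨ rsgLoad n a r = k + 1)
    (hb : ∀ r ∈ Finset.Icc 1 m, rsgLoad n b r = k ∨ rsgLoad n b r = k + 1)
    (hsh : ∀ i ∈ Finset.Icc 1 n, ∀ i' ∈ Finset.Icc 1 n, i ≠ i' →
        ¬ (a i = a i' ∧ rsgLoad n a (a i) = k + 1 ∧
            b i = b i' ∧ rsgLoad n b (b i) = k + 1)) :
    (∀ i ∈ Finset.Icc 1 n, ¬ rsgUniDev n m c a b i) ∧
      (∀ i ∈ Finset.Icc 1 n, ∀ i' ∈ Finset.Icc 1 n, i ≠ i' →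
        ¬ rsgPairDev n m c a b i i') := by
  obtain ⟨d, mono, up, lo⟩ := rsg_gain n k c hk hm1 hconv
  constructor
  · rintro i hi ⟨p, q, hp, hq, h⟩
    unfold rsgCost at h
    have h1 := rsg_uni_step n m k a i p hi (hab i hi).1 hp ha
    have h2 := rsg_uni_step n m k b i q hi (hab i hi).2 hq hb
    have := mono _ _ (by omega) h1.1 (rsgLoad_le _ _ _) h1.2
    have := mono _ _ (by omega) h2.1 (rsgLoad_le _ _ _) h2.2
    linarith
  · rintro i hi i' hi' hne ⟨p, q, p', q', hp, hq, hp', hq', h, h'⟩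
    unfold rsgCost at h h'
    have s := hsh i hi i' hi' hne
    generalize hf : Function.update (Function.update a i p) i' p' = f at *
    generalize hg : Function.update (Function.update b i q) i' q' = g at *
    have h1 := rsg_pair_step n m k a i i' p p' hi hi' hne (hab i hi).1 (hab i' hi').1 hp hp' ha
      _ _ _ _ f hf.symm rfl rfl rfl rfl
    have h2 := rsg_pair_step n m k b i i' q q' hi hi' hne (hab i hi).2 (hab i' hi').2 hq hq' hb
      _ _ _ _ g hg.symm rfl rfl rfl rfl
    have b1 := rsgLoad_le n f (f i)
    have b2 := rsgLoad_le n f (f i')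
    have b3 := rsgLoad_le n g (g i)
    have b4 := rsgLoad_le n g (g i')
    generalize rsgLoad n a (a i) = l1 at *
    generalize rsgLoad n a (a i') = l1' at *
    generalize rsgLoad n b (b i) = l2 at *
    generalize rsgLoad n b (b i') = l2' at *
    generalize rsgLoad n f (f i) = N1 at *
    generalize rsgLoad n f (f i') = N1' at *
    generalize rsgLoad n g (g i) = N2 at *
    generalize rsgLoad n g (g i') = N2' at *
    obtain ⟨⟨p1, p2, p3, p4⟩, ⟨k1, k1'⟩, ⟨u1, u1'⟩, o1, w1⟩ := h1
    obtain ⟨⟨r1, r2, r3, r4⟩, ⟨k2, k2'⟩, ⟨u2, u2'⟩, o2, w2⟩ := h2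
    have U1 := up l1 N1 p3 u1 b1 p1 k1
    have U1' := up l1' N1' p4 u1' b2 p2 k1'
    have U2 := up l2 N2 r3 u2 b3 r1 k2
    have U2' := up l2' N2' r4 u2' b4 r2 k2'
    have fin : ∀ x x' y y' M M' K K' : ℕ, 1 ≤ x → 1 ≤ x' → 1 ≤ y → 1 ≤ y' →
        1 ≤ M → 1 ≤ M' → 1 ≤ K → 1 ≤ K' → M ≤ n → M' ≤ n → K ≤ n → K' ≤ n →
        c x - c M ≤ d → c x' - c M' ≤ d → (x ≤ M ∨ x' ≤ M') →
        ((K < y → y' ≤ k ∧ k + 1 ≤ K') ∧ (K' < y' → y ≤ k ∧ k + 1 ≤ K)) →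
        c M + c K < c x + c y → c M' + c K' < c x' + c y' → False := by
      intro x x' y y' M M' K K' x1 x1' y1 y1' M1 M1' K1 K1' Mn Mn' Kn Kn' d1 d1' o w g1 g2
      rcases o with o | o
      · have e := mono x M M1 o Mn x1
        have : K < y := by
          by_contra hc
          have := mono y K K1 (by omega) Kn y1
          linarith
        have := lo y' K' y1' (w.1 this).1 (w.1 this).2 Kn'
        linarith
      · have e := mono x' M' M1' o Mn' x1'
        have : K' < y' := by
          by_contra hc
          have := mono y' K' K1' (by omega) Kn' y1'
          linarith
        have := lo y K y1 (w.2 this).1 (w.2 this).2 Kn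
        linarith
    by_cases hs : a i = a i' ∧ l1 = k + 1
    · have w := w2 (fun t => s ⟨hs.1, hs.2, t.1, t.2⟩)
      exact fin l1 l1' l2 l2' N1 N1' N2 N2' p1 p2 r1 r2 p3 p4 r3 r4 b1 b2 b3 b4 U1 U1' o1 w h h'
    · have w := w1 hs
      exact fin l2 l2' l1 l1' N2 N2' N1 N1' r1 r2 p1 p2 r3 r4 p3 p4 b3 b4 b1 b2 U2 U2' o2 w
        (by linarith) (by linarith)

/-- If `q = n mod m` satisfies `0 < q ≤ m/2`, the two-step resource selection game
(with a nondecreasing convex cost function) has a profile that is nearly balanced in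
both steps, in which no two distinct agents share a resource that is full in step 1 and
also share a resource that is full in step 2; consequently no single agent has a
strictly cost-decreasing unilateral deviation and no pair of distinct agents has a
strict deviation. (Here `⌊n/m⌋ = n/m` and `⌈n/m⌉ = n/m + 1` since `n mod m > 0`.) -/
theorem rsg_two_step_small_q_exists_two_strong_equilibrium
    (n m : ℕ) (c : ℕ → ℝ)
    (hm : 2 ≤ m) (hn : 1 ≤ n)
    (hmono : ∀ i, 1 ≤ i → i < n → c i ≤ c (i + 1))
    (hconv : ∀ i j, 1 ≤ i → i < j → j < n → c (i + 1) - c i ≤ c (j + 1) - c j)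
    (hq : 0 < n % m) (hq2 : 2 * (n % m) ≤ m) :
    ∃ a b : ℕ → ℕ,
      (∀ i ∈ Finset.Icc 1 n, a i ∈ Finset.Icc 1 m ∧ b i ∈ Finset.Icc 1 m) ∧
      (∀ r ∈ Finset.Icc 1 m, rsgLoad n a r = n / m ∨ rsgLoad n a r = n / m + 1) ∧
      (∀ r ∈ Finset.Icc 1 m, rsgLoad n b r = n / m ∨ rsgLoad n b r = n / m + 1) ∧
      (∀ i ∈ Finset.Icc 1 n, ∀ i' ∈ Finset.Icc 1 n, i ≠ i' →
        ¬ (a i = a i' ∧ rsgLoad n a (a i) = n / m + 1 ∧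
            b i = b i' ∧ rsgLoad n b (b i) = n / m + 1)) ∧
      (∀ i ∈ Finset.Icc 1 n, ¬ rsgUniDev n m c a b i) ∧
      (∀ i ∈ Finset.Icc 1 n, ∀ i' ∈ Finset.Icc 1 n, i ≠ i' →
        ¬ rsgPairDev n m c a b i i') := by
  have hm0 : 0 < m := by omega
  have hdm := Nat.div_add_mod n m
  have hml : ∀ j, (j - 1) % m < m := fun j => Nat.mod_lt _ hm0
  have hk : n / m + 1 ≤ n := by
    have : 2 * (n / m) ≤ m * (n / m) := Nat.mul_le_mul_right _ hm
    omega
  have hA : ∀ r ∈ Finset.Icc 1 m, rsgLoad n (fun j => (j - 1) % m + 1) r =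
      n / m + if r - 1 < n % m then 1 else 0 := by
    intro r hr
    rw [Finset.mem_Icc] at hr
    have := rsg_aload n m (r - 1) hm0 (by omega)
    rwa [Nat.sub_add_cancel hr.1] at this
  have hB := rsg_bload n m hm0 (fun j => (j - 1) % m + 1)
  have hab : ∀ i ∈ Finset.Icc 1 n, (fun j => (j - 1) % m + 1) i ∈ Finset.Icc 1 m ∧
      (fun i => (fun j => (j - 1) % m + 1) (rsgRefl n m i)) i ∈ Finset.Icc 1 m := by
    intro i _
    have h1 := hml i
    have h2 := hml (rsgRefl n m i)
    simp only [Finset.mem_Icc]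
    omega
  have ha : ∀ r ∈ Finset.Icc 1 m, rsgLoad n (fun j => (j - 1) % m + 1) r = n / m ∨
      rsgLoad n (fun j => (j - 1) % m + 1) r = n / m + 1 := by
    intro r hr
    rw [hA r hr]
    split_ifs <;> simp
  have hb : ∀ r ∈ Finset.Icc 1 m,
      rsgLoad n (fun i => (fun j => (j - 1) % m + 1) (rsgRefl n m i)) r = n / m ∨
      rsgLoad n (fun i => (fun j => (j - 1) % m + 1) (rsgRefl n m i)) r = n / m + 1 := by
    intro r hr
    rw [hB r]; exact ha r hr
  have big : ∀ i ∈ Finset.Icc 1 n, (i - 1) % m < n % m → (rsgRefl n m i - 1) % m < n % m →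
      i - 1 = m * (n / m) + (i - 1) % m := by
    intro i hi h1 h2
    rw [Finset.mem_Icc] at hi
    have hgt : ¬ i ≤ m * (n / m) := by
      intro hle
      have := (rsgRefl_spec n m i hm0 hi.1 hle).2.1
      omega
    have hd := Nat.div_add_mod (i - 1) m
    have e1 : n / m ≤ (i - 1) / m := by
      rw [Nat.le_div_iff_mul_le hm0, mul_comm]; omega
    have e2 : (i - 1) / m ≤ n / m := Nat.div_le_div_right (by omega)
    have e3 : (i - 1) / m = n / m := le_antisymm e2 e1
    rw [e3] at hd
    exact hd.symm
  have full : ∀ j, rsgLoad n (fun j => (j - 1) % m + 1) ((j - 1) % m + 1) = n / m + 1 →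
      (j - 1) % m < n % m := by
    intro j h
    rw [rsg_aload n m _ hm0 (hml j)] at h
    by_contra hc
    rw [if_neg hc] at h
    omega
  have hsh : ∀ i ∈ Finset.Icc 1 n, ∀ i' ∈ Finset.Icc 1 n, i ≠ i' →
        ¬ ((fun j => (j - 1) % m + 1) i = (fun j => (j - 1) % m + 1) i' ∧
            rsgLoad n (fun j => (j - 1) % m + 1) ((fun j => (j - 1) % m + 1) i) = n / m + 1 ∧
            (fun i => (fun j => (j - 1) % m + 1) (rsgRefl n m i)) i =
              (fun i => (fun j => (j - 1) % m + 1) (rsgRefl n m i)) i' ∧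
            rsgLoad n (fun i => (fun j => (j - 1) % m + 1) (rsgRefl n m i))
              ((fun i => (fun j => (j - 1) % m + 1) (rsgRefl n m i)) i) = n / m + 1) := by
    rintro i hi i' hi' hne ⟨h1, h2, h3, h4⟩
    rw [hB] at h4
    have f1 := full i h2
    have f2 := full (rsgRefl n m i) h4
    simp only at h1 h3
    have g1 := big i hi f1 f2
    have g2 := big i' hi' (by omega) (by omega)
    rw [Finset.mem_Icc] at hi hi'
    omega
  exact ⟨_, _, hab, ha, hb, hsh, rsg_no_dev n m (n / m) c _ _ hk hmono hconv hab ha hb hsh⟩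
end

section
/- Let n, m be positive integers and let f : {1,…,n} → {1,…,m} be a function all of whose fibers have size at most m. Then there exists g : {1,…,n} → {1,…,m} such that every fiber of g has size ⌊n/m⌋ or ⌈n/m⌉, and g is injective on every fiber of f (i.e., if f(i) = f(i') and g(i) = g(i') then i = i'). -/
/-- Combinatorial scattering construction: if `f : {1,…,n} → {1,…,m}` has all fibers of
size at most `m`, then there is `g : {1,…,n} → {1,…,m}` all of whose fibers have size
`⌊n/m⌋` or `⌈n/m⌉`, and which is injective on every fiber of `f`. -/
theorem exists_nearly_balanced_scattering
    (n m : ℕ) (hn : 1 ≤ n) (hm : 1 ≤ m) (f : ℕ → ℕ)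
    (hf : ∀ i ∈ Finset.Icc 1 n, f i ∈ Finset.Icc 1 m)
    (hfib : ∀ r : ℕ, ((Finset.Icc 1 n).filter (fun i => f i = r)).card ≤ m) :
    ∃ g : ℕ → ℕ,
      (∀ i ∈ Finset.Icc 1 n, g i ∈ Finset.Icc 1 m) ∧
      (∀ r ∈ Finset.Icc 1 m,
        ((Finset.Icc 1 n).filter (fun i => g i = r)).card = n / m ∨
        ((Finset.Icc 1 n).filter (fun i => g i = r)).card = (n + m - 1) / m) ∧
      (∀ i ∈ Finset.Icc 1 n, ∀ i' ∈ Finset.Icc 1 n,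
        f i = f i' → g i = g i' → i = i') := by
  classical
  let S : ℕ → Finset ℕ := fun i =>
    (Finset.Icc 1 n).filter (fun j => f j < f i ∨ (f j = f i ∧ j < i))
  let pos : ℕ → ℕ := fun i => (S i).card
  have memS : ∀ i j, j ∈ S i ↔ j ∈ Finset.Icc 1 n ∧ (f j < f i ∨ (f j = f i ∧ j < i)) := by
    intro i j
    simp only [S, Finset.mem_filter]
  have hmono : ∀ i ∈ Finset.Icc 1 n, ∀ i' : ℕ,
      (f i < f i' ∨ (f i = f i' ∧ i < i')) → pos i < pos i' := by
    intro i hi i' h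
    apply Finset.card_lt_card
    rw [Finset.ssubset_iff_of_subset]
    · refine ⟨i, (memS _ _).2 ⟨hi, h⟩, fun h' => ?_⟩
      have := ((memS _ _).1 h').2
      omega
    · intro j hj
      obtain ⟨h1, h2⟩ := (memS _ _).1 hj
      exact (memS _ _).2 ⟨h1, by omega⟩
  have hlt : ∀ i ∈ Finset.Icc 1 n, pos i < n := by
    intro i hi
    have : (S i).card < (Finset.Icc 1 n).card := by
      apply Finset.card_lt_card
      rw [Finset.ssubset_iff_of_subset (Finset.filter_subset _ _)]
      refine ⟨i, hi, fun h' => ?_⟩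
      have := ((memS _ _).1 h').2
      omega
    simpa using this
  have hinj : Set.InjOn pos (Finset.Icc 1 n : Finset ℕ) := by
    intro i hi j hj hij
    by_contra hne
    have hc : (f i < f j ∨ (f i = f j ∧ i < j)) ∨ (f j < f i ∨ (f j = f i ∧ j < i)) := by omega
    rcases hc with h | h
    · have := hmono i hi j h
      omega
    · have := hmono j hj i h
      omega
  have himg : (Finset.Icc 1 n).image pos = Finset.range n := by
    apply Finset.eq_of_subset_of_card_le
    · intro k hk
      obtain ⟨i, hi, rfl⟩ := Finset.mem_image.1 hk
      exact Finset.mem_range.2 (hlt i hi)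
    · rw [Finset.card_image_of_injOn hinj]
      simp
  have hclose : ∀ i ∈ Finset.Icc 1 n, ∀ i' ∈ Finset.Icc 1 n, f i = f i' →
      pos i' < pos i + m := by
    intro i hi i' hi' hff
    have hsub : S i' ⊆ S i ∪ ((Finset.Icc 1 n).filter (fun j => f j = f i')).erase i' := by
      intro j hj
      obtain ⟨h1, h2⟩ := (memS _ _).1 hj
      rw [Finset.mem_union, memS, Finset.mem_erase, Finset.mem_filter]
      rcases h2 with h2 | h2
      · exact Or.inl ⟨h1, by omega⟩
      · exact Or.inr ⟨by omega, h1, h2.1⟩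
    have h1 := (Finset.card_le_card hsub).trans (Finset.card_union_le _ _)
    have hmem : i' ∈ (Finset.Icc 1 n).filter (fun j => f j = f i') :=
      Finset.mem_filter.2 ⟨hi', rfl⟩
    rw [Finset.card_erase_of_mem hmem] at h1
    have h2 := hfib (f i')
    change (S i').card < (S i).card + m
    omega
  refine ⟨fun i => pos i % m + 1, ?_, ?_, ?_⟩
  · intro i _
    have := Nat.mod_lt (pos i) hm
    simp only [Finset.mem_Icc]
    omega
  · intro r hr
    rw [Finset.mem_Icc] at hr
    have hcard : ((Finset.Icc 1 n).filter (fun i => pos i % m + 1 = r)).card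
        = Nat.count (· ≡ (r - 1) [MOD m]) n := by
      rw [Nat.count_eq_card_filter_range, ← himg, Finset.filter_image,
        Finset.card_image_of_injOn (hinj.mono (by
          intro x hx
          exact (Finset.mem_filter.1 hx).1))]
      congr 1
      apply Finset.filter_congr
      intro i _
      unfold Nat.ModEq
      rw [Nat.mod_eq_of_lt (show r - 1 < m by omega)]
      omega
    simp only [hcard]
    rw [Nat.count_modEq_card n hm]
    split_ifs with h
    · right
      have hd := Nat.div_add_mod n m
      symm
      have hp : 0 < n % m := by omega
      have hl := Nat.mod_lt n hm
      rw [Nat.div_eq_iff hm]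
      have he : (n / m + 1) * m = m * (n / m) + m := by ring
      rw [he]
      omega
    · left
      rfl
  · intro i hi i' hi' hff hg
    have hg' : pos i % m = pos i' % m := by simpa using hg
    apply hinj hi hi'
    have h1 := hclose i hi i' hi' hff
    have h2 := hclose i' hi' i hi hff.symm
    rcases le_total (pos i) (pos i') with h | h
    · have := (Nat.modEq_iff_dvd' h).1 hg'
      have := Nat.eq_zero_of_dvd_of_lt this (by omega)
      omega
    · have := (Nat.modEq_iff_dvd' h).1 hg'.symm
      have := Nat.eq_zero_of_dvd_of_lt this (by omega)
      omega
end
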